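/- Let g be a psd sextic form in ℝ[x₀,x₁,x₂] that is reducible over ℝ, i.e. g = g₁·g₂ with forms g₁, g₂ of positive degree. Then g is a sum of squares of forms, and moreover its real projective zero set V_ℝ(g) either has at most 5 points or is infinite. -/

import Mathlib

open MvPolynomial

noncomputable section

/-- The real projective plane, as lines through the origin of `ℝ³`. -/
abbrev P2 := Projectivization ℝ (Fin 3 → ℝ)

/-- A polynomial is psd if it takes only nonnegative values on `ℝ³`. -/
def Psd (g : MvPolynomial (Fin 3) ℝ) : Prop := ∀ u : Fin 3 → ℝ, 0 ≤ eval u g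

/-- A polynomial is sos if it is a finite sum of squares. -/
def Sos (g : MvPolynomial (Fin 3) ℝ) : Prop :=
  ∃ (n : ℕ) (h : Fin n → MvPolynomial (Fin 3) ℝ), g = ∑ i, (h i) ^ 2

/-- A form vanishes at a point of `ℙ²(ℝ)` if it vanishes at a representative vector. -/
def VanishAt (g : MvPolynomial (Fin 3) ℝ) (P : P2) : Prop := eval P.rep g = 0

/-- A form is singular at a point of `ℙ²(ℝ)` if it and all its first partial
derivatives vanish at a representative vector. -/
def SingAt (g : MvPolynomial (Fin 3) ℝ) (P : P2) : Prop :=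
  eval P.rep g = 0 ∧ ∀ i, eval P.rep (pderiv i g) = 0

/-- `I_d(T)`: the space of degree-`d` forms vanishing at every point of `T`. -/
def Isub (d : ℕ) (T : Set P2) : Submodule ℝ (MvPolynomial (Fin 3) ℝ) :=
  (homogeneousSubmodule (Fin 3) ℝ d) ⊓
  { carrier := {f | ∀ P ∈ T, VanishAt f P}
    zero_mem' := by intro P _; simp [VanishAt]
    add_mem' := by
      intro a b ha hb P hP
      have h1 := ha P hP; have h2 := hb P hP
      unfold VanishAt at *; simp [h1, h2]
    smul_mem' := by
      intro c f hf P hP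
      have h1 := hf P hP
      unfold VanishAt at *; simp [smul_eq_C_mul, h1] }

/-- `I_d(2T)`: the space of degree-`d` forms singular at every point of `T`. -/
def Isub2 (d : ℕ) (T : Set P2) : Submodule ℝ (MvPolynomial (Fin 3) ℝ) :=
  (homogeneousSubmodule (Fin 3) ℝ d) ⊓
  { carrier := {f | ∀ P ∈ T, SingAt f P}
    zero_mem' := by intro P _; constructor <;> simp [SingAt]
    add_mem' := by
      intro a b ha hb P hP
      obtain ⟨h1, h2⟩ := ha P hP; obtain ⟨h3, h4⟩ := hb P hP
      exact ⟨by simp [h1, h3], fun i => by simp [h2 i, h4 i]⟩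
    smul_mem' := by
      intro c f hf P hP
      obtain ⟨h1, h2⟩ := hf P hP
      refine ⟨by simp [smul_eq_C_mul, h1], fun i => ?_⟩
      have := h2 i
      simp [smul_eq_C_mul, this] }

/-- `I₃(T)²`: the span of products of two cubics vanishing on `T`. -/
def IsqCubic (T : Set P2) : Submodule ℝ (MvPolynomial (Fin 3) ℝ) :=
  Submodule.span ℝ {h | ∃ f₁ ∈ Isub 3 T, ∃ f₂ ∈ Isub 3 T, h = f₁ * f₂}

/-- No 4 points of `T` on a line, no 7 on a conic. -/
def GenPos (T : Set P2) : Prop :=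
  (∀ l : MvPolynomial (Fin 3) ℝ, l ≠ 0 → l.IsHomogeneous 1 →
    {P ∈ T | VanishAt l P}.encard ≤ 3) ∧
  (∀ c : MvPolynomial (Fin 3) ℝ, c ≠ 0 → c.IsHomogeneous 2 →
    {P ∈ T | VanishAt c P}.encard ≤ 6)

/-- The real projective zero set of `g`. -/
def VR (g : MvPolynomial (Fin 3) ℝ) : Set P2 := {P | VanishAt g P}


/-- functions on `ℝ³` given by a form of degree `d` -/
def IsForm (d : ℕ) (F : (Fin 3 → ℝ) → ℝ) : Prop :=
  ∃ p : MvPolynomial (Fin 3) ℝ, p.IsHomogeneous d ∧ ∀ v, F v = eval v p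

/-- action of a linear map on polynomials -/
def linAct (T : (Fin 3 → ℝ) →ₗ[ℝ] (Fin 3 → ℝ)) :
    MvPolynomial (Fin 3) ℝ →ₐ[ℝ] MvPolynomial (Fin 3) ℝ :=
  aeval (fun i => ∑ j, C (T (Pi.single j 1) i) * X j)

lemma eval_linAct (T : (Fin 3 → ℝ) →ₗ[ℝ] (Fin 3 → ℝ)) (p : MvPolynomial (Fin 3) ℝ)
    (v : Fin 3 → ℝ) : eval v (linAct T p) = eval (T v) p := by
  have hT : T v = fun i => ∑ j, T (Pi.single j 1) i * v j := by
    ext i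
    conv_lhs => rw [LinearMap.pi_apply_eq_sum_univ T v]
    simp only [Finset.sum_apply, Pi.smul_apply, smul_eq_mul]
    refine Finset.sum_congr rfl fun j _ => ?_
    rw [mul_comm]
    have : (fun k => if j = k then (1:ℝ) else 0) = Pi.single j 1 := by
      ext k
      simp [Pi.single_apply, eq_comm]
    rw [this]
  rw [hT]
  induction p using MvPolynomial.induction_on with
  | C a => simp [linAct]
  | add p q hp hq => simp [hp, hq]
  | mul_X p i hp => simp [hp]; left; simp [linAct]

lemma linAct_homog (T : (Fin 3 → ℝ) →ₗ[ℝ] (Fin 3 → ℝ)) {p : MvPolynomial (Fin 3) ℝ} {d : ℕ}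
    (hp : p.IsHomogeneous d) : (linAct T p).IsHomogeneous d := by
  have := hp.aeval (n := 1) (fun i => ∑ j, C (T (Pi.single j 1) i) * X j)
    (fun i => IsHomogeneous.sum _ _ _ (fun j _ => isHomogeneous_C_mul_X _ _))
  simpa [linAct] using this

/-- action of a linear equivalence on polynomials -/
def linEquiv (T : (Fin 3 → ℝ) ≃ₗ[ℝ] (Fin 3 → ℝ)) :
    MvPolynomial (Fin 3) ℝ ≃ₐ[ℝ] MvPolynomial (Fin 3) ℝ :=
  { linAct T.toLinearMap with
    invFun := linAct T.symm.toLinearMap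
    left_inv := fun p => MvPolynomial.funext fun v => by
      simp [eval_linAct]
    right_inv := fun p => MvPolynomial.funext fun v => by
      simp [eval_linAct] }

lemma eval_linEquiv (T : (Fin 3 → ℝ) ≃ₗ[ℝ] (Fin 3 → ℝ)) (p : MvPolynomial (Fin 3) ℝ)
    (v : Fin 3 → ℝ) : eval v (linEquiv T p) = eval (T v) p := eval_linAct T.toLinearMap p v

lemma IsForm.comp {d : ℕ} {F : (Fin 3 → ℝ) → ℝ} (h : IsForm d F)
    (T : (Fin 3 → ℝ) →ₗ[ℝ] (Fin 3 → ℝ)) : IsForm d (fun v => F (T v)) := by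
  obtain ⟨p, hp, h⟩ := h
  exact ⟨linAct T p, linAct_homog T hp, fun v => by rw [eval_linAct]; exact h _⟩

lemma eval_smul_form {p : MvPolynomial (Fin 3) ℝ} {d : ℕ} (hp : p.IsHomogeneous d) (t : ℝ)
    (v : Fin 3 → ℝ) : eval (t • v) p = t ^ d * eval v p := by
  have e : (t • v) = fun i => t * v i := rfl
  rw [e, eval_eq, eval_eq, Finset.mul_sum]
  refine Finset.sum_congr rfl fun m hm => ?_
  have : t ^ d = ∏ i ∈ m.support, t ^ m i := by
    rw [Finset.prod_pow_eq_pow_sum, ← hp.degree_eq_sum_deg_support hm]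
  rw [this]
  simp only [mul_pow, Finset.prod_mul_distrib]
  ring

lemma IsForm.smul {d : ℕ} {F : (Fin 3 → ℝ) → ℝ} (h : IsForm d F) (t : ℝ) (v : Fin 3 → ℝ) :
    F (t • v) = t ^ d * F v := by
  obtain ⟨p, hp, h⟩ := h
  rw [h, h, eval_smul_form hp]

lemma continuous_eval_poly (p : MvPolynomial (Fin 3) ℝ) :
    Continuous (fun v : Fin 3 → ℝ => eval v p) := MvPolynomial.continuous_eval p

lemma IsForm.continuous {d : ℕ} {F : (Fin 3 → ℝ) → ℝ} (h : IsForm d F) : Continuous F := by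
  obtain ⟨p, hp, h⟩ := h
  rw [show F = fun v => eval v p from _root_.funext h]
  exact continuous_eval_poly p

lemma IsForm.sub {d : ℕ} {F G : (Fin 3 → ℝ) → ℝ} (h : IsForm d F) (h' : IsForm d G) :
    IsForm d (fun v => F v - G v) := by
  obtain ⟨p, hp, h⟩ := h
  obtain ⟨q, hq, h'⟩ := h'
  exact ⟨p - q, hp.sub hq, fun v => by simp [h, h']⟩

/-- splitting off a variable -/
lemma homog_split {p : MvPolynomial (Fin 3) ℝ} {d : ℕ} (hp : p.IsHomogeneous (d + 1)) :
    ∃ q : Fin 3 → MvPolynomial (Fin 3) ℝ, (∀ i, (q i).IsHomogeneous d) ∧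
      p = ∑ i, X i * q i := by
  have key : ∀ m ∈ p.support, ∃ i, m i ≠ 0 := by
    intro m hm
    by_contra hcon
    push Not at hcon
    have h1 := hp.degree_eq_sum_deg_support hm
    have : m = 0 := Finsupp.ext hcon
    simp [this] at h1
  have hm : ∀ m ∈ p.support, ∃ q : Fin 3 → MvPolynomial (Fin 3) ℝ,
      (∀ i, (q i).IsHomogeneous d) ∧ monomial m (coeff m p) = ∑ i, X i * q i := by
    intro m hm
    obtain ⟨i, hi⟩ := key m hm
    have hmi : Finsupp.single i 1 + (m - Finsupp.single i 1) = m :=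
      add_tsub_cancel_of_le (Finsupp.single_le_iff.2 (Nat.one_le_iff_ne_zero.2 hi))
    refine ⟨fun j => if j = i then monomial (m - Finsupp.single i 1) (coeff m p) else 0, ?_, ?_⟩
    · intro j
      dsimp only
      split_ifs
      · apply isHomogeneous_monomial
        have h1 : m.degree = d + 1 := by
          have := hp.degree_eq_sum_deg_support hm
          rw [this]; rfl
        rw [← hmi, map_add, Finsupp.degree_single] at h1
        omega
      · exact isHomogeneous_zero _ _ _
    · rw [Finset.sum_eq_single i]
      · simp only [if_true]
        rw [X, monomial_mul, hmi, one_mul]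
      · intro j _ hj
        simp [hj]
      · simp
  choose! q hq1 hq2 using hm
  refine ⟨fun i => ∑ m ∈ p.support, q m i, fun i => IsHomogeneous.sum _ _ _
    fun m hm => hq1 m hm i, ?_⟩
  conv_lhs => rw [p.as_sum, Finset.sum_congr rfl hq2]
  rw [Finset.sum_comm]
  simp [Finset.mul_sum]

lemma IsForm.split {d : ℕ} {F : (Fin 3 → ℝ) → ℝ} (h : IsForm (d + 1) F) :
    ∃ A B C : (Fin 3 → ℝ) → ℝ, IsForm d A ∧ IsForm d B ∧ IsForm d C ∧
      ∀ v, F v = v 0 * A v + v 1 * B v + v 2 * C v := by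
  obtain ⟨p, hp, h⟩ := h
  obtain ⟨q, hq, e⟩ := homog_split hp
  exact ⟨_, _, _, ⟨q 0, hq 0, fun v => rfl⟩, ⟨q 1, hq 1, fun v => rfl⟩,
    ⟨q 2, hq 2, fun v => rfl⟩, fun v => by rw [h, e]; simp [Fin.sum_univ_three]⟩

/-- explicit quadratic form -/
def qf (c : Fin 6 → ℝ) (v : Fin 3 → ℝ) : ℝ :=
  c 0 * v 0 ^ 2 + c 1 * v 1 ^ 2 + c 2 * v 2 ^ 2 + c 3 * (v 1 * v 2) + c 4 * (v 0 * v 2)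
    + c 5 * (v 0 * v 1)

/-- its polynomial -/
def qp (c : Fin 6 → ℝ) : MvPolynomial (Fin 3) ℝ :=
  C (c 0) * X 0 ^ 2 + C (c 1) * X 1 ^ 2 + C (c 2) * X 2 ^ 2 + C (c 3) * (X 1 * X 2)
    + C (c 4) * (X 0 * X 2) + C (c 5) * (X 0 * X 1)

lemma eval_qp (c : Fin 6 → ℝ) (v : Fin 3 → ℝ) : eval v (qp c) = qf c v := by
  simp [qp, qf]

lemma qp_homog (c : Fin 6 → ℝ) : (qp c).IsHomogeneous 2 := by
  have h1 : ∀ (a : ℝ) (i : Fin 3), (C a * X i ^ 2 : MvPolynomial (Fin 3) ℝ).IsHomogeneous 2 :=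
    fun a i => isHomogeneous_C_mul_X_pow a i 2
  have h2 : ∀ (a : ℝ) (i j : Fin 3),
      (C a * (X i * X j) : MvPolynomial (Fin 3) ℝ).IsHomogeneous 2 :=
    fun a i j => ((isHomogeneous_X ℝ i).mul (isHomogeneous_X ℝ j)).C_mul a
  unfold qp
  exact (((((h1 _ _).add (h1 _ _)).add (h1 _ _)).add (h2 _ _ _)).add (h2 _ _ _)).add (h2 _ _ _)

lemma qf_isForm (c : Fin 6 → ℝ) : IsForm 2 (qf c) :=
  ⟨qp c, qp_homog c, fun v => (eval_qp c v).symm⟩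

lemma IsForm.zero {F : (Fin 3 → ℝ) → ℝ} (h : IsForm 0 F) : ∃ a, ∀ v, F v = a := by
  obtain ⟨p, hp, h⟩ := h
  have := (totalDegree_zero_iff_isHomogeneous (p := p)).2 hp
  rw [totalDegree_eq_zero_iff_eq_C] at this
  refine ⟨coeff 0 p, fun v => ?_⟩
  rw [h, this]; simp

lemma IsForm.one {F : (Fin 3 → ℝ) → ℝ} (h : IsForm 1 F) :
    ∃ a b c, ∀ v, F v = a * v 0 + b * v 1 + c * v 2 := by
  obtain ⟨A, B, C, hA, hB, hC, e⟩ := h.split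
  obtain ⟨a, ha⟩ := hA.zero
  obtain ⟨b, hb⟩ := hB.zero
  obtain ⟨c, hc⟩ := hC.zero
  exact ⟨a, b, c, fun v => by rw [e, ha, hb, hc]; ring⟩

lemma IsForm.two {F : (Fin 3 → ℝ) → ℝ} (h : IsForm 2 F) :
    ∃ c, ∀ v, F v = qf c v := by
  obtain ⟨A, B, C, hA, hB, hC, e⟩ := h.split
  obtain ⟨a, a', a'', ha⟩ := hA.one
  obtain ⟨b, b', b'', hb⟩ := hB.one
  obtain ⟨c, c', c'', hc⟩ := hC.one
  exact ⟨![a, b', c'', b'' + c', a'' + c, a' + b], fun v => by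
    rw [e, ha, hb, hc]; simp [qf]; ring⟩

lemma IsForm.three {F : (Fin 3 → ℝ) → ℝ} (h : IsForm 3 F) :
    ∃ a b c : ℝ, ∃ d : Fin 3 → ℝ, ∃ e : Fin 4 → ℝ, ∀ v, F v = a * v 0 ^ 3 +
      v 0 ^ 2 * (b * v 1 + c * v 2) + v 0 * (d 0 * v 1 ^ 2 + d 1 * (v 1 * v 2) + d 2 * v 2 ^ 2)
      + (e 0 * v 1 ^ 3 + e 1 * v 1 ^ 2 * v 2 + e 2 * v 1 * v 2 ^ 2 + e 3 * v 2 ^ 3) := by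
  obtain ⟨A, B, C, hA, hB, hC, e⟩ := h.split
  obtain ⟨a, ha⟩ := hA.two
  obtain ⟨b, hb⟩ := hB.two
  obtain ⟨c, hc⟩ := hC.two
  exact ⟨a 0, a 5 + b 0, a 4 + c 0, ![a 1 + b 5, a 3 + b 4 + c 5, a 2 + c 4],
    ![b 1, b 3 + c 1, b 2 + c 3, c 2], fun v => by
    rw [e, ha, hb, hc]; simp [qf]; ring⟩

lemma IsForm.four {F : (Fin 3 → ℝ) → ℝ} (h : IsForm 4 F) :
    ∃ a b c : ℝ, ∃ d : Fin 3 → ℝ, ∃ e : Fin 4 → ℝ, ∃ f : Fin 5 → ℝ, ∀ v, F v = a * v 0 ^ 4 +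
      v 0 ^ 3 * (b * v 1 + c * v 2) +
      v 0 ^ 2 * (d 0 * v 1 ^ 2 + d 1 * (v 1 * v 2) + d 2 * v 2 ^ 2)
      + 2 * v 0 * (e 0 * v 1 ^ 3 + e 1 * v 1 ^ 2 * v 2 + e 2 * v 1 * v 2 ^ 2 + e 3 * v 2 ^ 3)
      + (f 0 * v 1 ^ 4 + f 1 * v 1 ^ 3 * v 2 + f 2 * v 1 ^ 2 * v 2 ^ 2 + f 3 * v 1 * v 2 ^ 3
        + f 4 * v 2 ^ 4) := by
  obtain ⟨A, B, C, hA, hB, hC, e⟩ := h.split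
  obtain ⟨a, a1, a2, a3, a4, ha⟩ := hA.three
  obtain ⟨b, b1, b2, b3, b4, hb⟩ := hB.three
  obtain ⟨c, c1, c2, c3, c4, hc⟩ := hC.three
  exact ⟨a, a1 + b, a2 + c, ![a3 0 + b1, a3 1 + b2 + c1, a3 2 + c2],
    ![(a4 0 + b3 0) / 2, (a4 1 + b3 1 + c3 0) / 2, (a4 2 + b3 2 + c3 1) / 2, (a4 3 + c3 2) / 2],
    ![b4 0, b4 1 + c4 0, b4 2 + c4 1, b4 3 + c4 2, c4 3], fun v => by
    rw [e, ha, hb, hc]; simp; ring⟩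

/-- a linear equivalence with prescribed values on an independent family -/
lemma exists_equiv3 {u v w : Fin 3 → ℝ} (h : LinearIndependent ℝ ![u, v, w]) :
    ∃ T : (Fin 3 → ℝ) ≃ₗ[ℝ] (Fin 3 → ℝ), ∀ x, T x = x 0 • u + x 1 • v + x 2 • w := by
  let b := basisOfLinearIndependentOfCardEqFinrank h (by simp)
  refine ⟨b.equivFun.symm, fun x => ?_⟩
  rw [Module.Basis.equivFun_symm_apply]
  simp [Fin.sum_univ_three, b]

lemma exists_indep3 {u v : Fin 3 → ℝ} (h : LinearIndependent ℝ ![u, v]) :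
    ∃ w, LinearIndependent ℝ ![w, u, v] := by
  obtain ⟨w, hw⟩ : ∃ w, w ∉ Submodule.span ℝ (Set.range ![u, v]) := by
    by_contra hcon
    push Not at hcon
    have h1 : Submodule.span ℝ (Set.range ![u, v]) = ⊤ := by
      rw [eq_top_iff]; exact fun x _ => hcon x
    have h2 := finrank_span_eq_card h
    rw [h1] at h2
    simp at h2
  exact ⟨w, linearIndependent_finCons.2 ⟨h, hw⟩⟩

lemma exists_indep2 {u : Fin 3 → ℝ} (h : u ≠ 0) : ∃ v, LinearIndependent ℝ ![u, v] := by
  obtain ⟨w, hw⟩ : ∃ w, w ∉ Submodule.span ℝ {u} := by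
    by_contra hcon
    push Not at hcon
    have h1 : Submodule.span ℝ {u} = ⊤ := by
      rw [eq_top_iff]; exact fun x _ => hcon x
    have h2 := finrank_span_singleton (K := ℝ) h
    rw [h1] at h2
    simp at h2
  refine ⟨w, (LinearIndependent.pair_iff' h).2 fun a ha => hw ?_⟩
  exact Submodule.mem_span_singleton.2 ⟨a, ha⟩

/-- nonnegativity extends by continuity -/
lemma nonneg_of_pos {g : ℝ → ℝ} (hg : Continuous g) (h : ∀ t, 0 < t → 0 ≤ g t) : 0 ≤ g 0 := by
  have h1 : Filter.Tendsto g (nhdsWithin 0 (Set.Ioi 0)) (nhds (g 0)) :=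
    hg.continuousAt.tendsto.mono_left nhdsWithin_le_nhds
  exact ge_of_tendsto h1 (by filter_upwards [self_mem_nhdsWithin] with t ht using h t ht)

/-- comparison of homogeneous functions by compactness -/
lemma compact_compare {E : Type*} [NormedAddCommGroup E] [NormedSpace ℝ E] [ProperSpace E]
    {φ ψ : E → ℝ} (hφ : Continuous φ) (hψ : Continuous ψ) (n : ℕ)
    (hφn : ∀ (t : ℝ) v, φ (t • v) = t ^ n * φ v) (hψn : ∀ (t : ℝ) v, ψ (t • v) = t ^ n * ψ v)
    (hpos : ∀ v, v ≠ 0 → 0 < φ v) (hn : n ≠ 0) : ∃ μ > 0, ∀ v, μ * ψ v ≤ φ v := by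
  by_cases hne : (Metric.sphere (0 : E) 1).Nonempty
  · obtain ⟨a, ha, hamin⟩ := (isCompact_sphere (0 : E) 1).exists_isMinOn hne hφ.continuousOn
    obtain ⟨b, hb, hbmax⟩ := (isCompact_sphere (0 : E) 1).exists_isMaxOn hne hψ.continuousOn
    have ha0 : 0 < φ a := hpos a (by rintro rfl; simp at ha)
    have hM : 0 < |ψ b| + 1 := by positivity
    refine ⟨φ a / (|ψ b| + 1), by positivity, fun v => ?_⟩
    by_cases hv : v = 0
    · subst hv
      have h1 := hφn 0 0
      have h2 := hψn 0 0
      simp [hn] at h1 h2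
      rw [h1, h2]; simp
    · have hvn : 0 < ‖v‖ := norm_pos_iff.2 hv
      have hs : ‖v‖⁻¹ • v ∈ Metric.sphere (0 : E) 1 := by
        simp [norm_smul, hvn.ne']
      have e : v = ‖v‖ • (‖v‖⁻¹ • v) := by rw [smul_smul, mul_inv_cancel₀ hvn.ne', one_smul]
      have h1 : φ a ≤ φ (‖v‖⁻¹ • v) := hamin hs
      have h2 : ψ (‖v‖⁻¹ • v) ≤ ψ b := hbmax hs
      generalize ‖v‖⁻¹ • v = w at *
      rw [e, hφn, hψn]
      have h3 : φ a / (|ψ b| + 1) * ψ w ≤ φ w := by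
        rw [div_mul_eq_mul_div, div_le_iff₀ hM]
        have : ψ w ≤ |ψ b| + 1 := by linarith [le_abs_self (ψ b)]
        nlinarith
      have : 0 < ‖v‖ ^ n := by positivity
      nlinarith
  · refine ⟨1, one_pos, fun v => ?_⟩
    have hv : v = 0 := by
      by_contra hv
      exact hne ⟨‖v‖⁻¹ • v, by simp [norm_smul, hv]⟩
    subst hv
    have h1 := hφn 0 0
    have h2 := hψn 0 0
    simp [hn] at h1 h2
    rw [h1, h2]; simp

/-- `F` dominates a nonzero square of a quadratic form -/
def Dom (F : (Fin 3 → ℝ) → ℝ) : Prop :=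
  ∃ c : Fin 6 → ℝ, (∃ v, qf c v ≠ 0) ∧ ∀ v, qf c v ^ 2 ≤ F v

lemma Dom.of_comp {F : (Fin 3 → ℝ) → ℝ} (T : (Fin 3 → ℝ) ≃ₗ[ℝ] (Fin 3 → ℝ))
    (h : Dom (fun v => F (T v))) : Dom F := by
  obtain ⟨c, ⟨v, hv⟩, h⟩ := h
  obtain ⟨c', hc'⟩ := ((qf_isForm c).comp T.symm.toLinearMap).two
  refine ⟨c', ⟨T v, ?_⟩, fun w => ?_⟩
  · rw [← hc']; simpa using hv
  · rw [← hc']; simpa using h (T.symm w)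

lemma lin_zero {s : ℝ} {k : ℝ → ℝ} (hk : Continuous k) (h : ∀ t, 0 ≤ s * t + t ^ 2 * k t) :
    s = 0 := by
  have h1 : 0 ≤ s := by
    have := nonneg_of_pos (g := fun t => s + t * k t) (by fun_prop) (fun t ht => by
      have := h t
      by_contra hc
      push Not at hc
      nlinarith)
    simpa using this
  have h2 : 0 ≤ -s := by
    have := nonneg_of_pos (g := fun t => -s + t * k (-t)) (by fun_prop) (fun t ht => by
      have := h (-t)
      by_contra hc
      push Not at hc
      nlinarith)
    simpa using this
  linarith

lemma quad_nonneg {A B C : ℝ} (h : ∀ x, 0 ≤ x ^ 2 * A + 2 * x * B + C) :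
    0 ≤ A ∧ 0 ≤ C ∧ B ^ 2 ≤ A * C := by
  refine ⟨?_, by simpa using h 0, ?_⟩
  · have := nonneg_of_pos (g := fun t => A + 2 * B * t + C * t ^ 2) (by fun_prop) (fun t ht => by
      have := h t⁻¹
      have e : A + 2 * B * t + C * t ^ 2 = t ^ 2 * (t⁻¹ ^ 2 * A + 2 * t⁻¹ * B + C) := by
        field_simp
      rw [e]; positivity)
    simpa using this
  · have := discrim_le_zero (a := A) (b := 2 * B) (c := C) (fun x => by have := h x; linarith)
    unfold discrim at this
    linarith

def bq (d : Fin 3 → ℝ) (y z : ℝ) : ℝ := d 0 * y ^ 2 + d 1 * (y * z) + d 2 * z ^ 2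
def bc (e : Fin 4 → ℝ) (y z : ℝ) : ℝ :=
  e 0 * y ^ 3 + e 1 * y ^ 2 * z + e 2 * y * z ^ 2 + e 3 * z ^ 3
def bt (f : Fin 5 → ℝ) (y z : ℝ) : ℝ :=
  f 0 * y ^ 4 + f 1 * y ^ 3 * z + f 2 * y ^ 2 * z ^ 2 + f 3 * y * z ^ 3 + f 4 * z ^ 4

def E0 : Fin 3 → ℝ := ![1, 0, 0]
def E1 : Fin 3 → ℝ := ![0, 1, 0]
def E2 : Fin 3 → ℝ := ![0, 0, 1]

lemma shape {F : (Fin 3 → ℝ) → ℝ} (hF : IsForm 4 F) (hpsd : ∀ v, 0 ≤ F v) (h0 : F E0 = 0) :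
    ∃ d e f, ∀ v, F v = v 0 ^ 2 * bq d (v 1) (v 2) + 2 * v 0 * bc e (v 1) (v 2)
      + bt f (v 1) (v 2) := by
  obtain ⟨a, b, c, d, e, f, h⟩ := hF.four
  have ha : a = 0 := by
    have := h E0
    rw [h0] at this
    simpa [E0] using this.symm
  have hb : b = 0 := by
    refine lin_zero (k := fun t => d 0 + 2 * e 0 * t + f 0 * t ^ 2) (by fun_prop) fun t => ?_
    have := hpsd ![1, t, 0]
    rw [h, ha] at this
    simp at this
    linarith
  have hc : c = 0 := by
    refine lin_zero (k := fun t => d 2 + 2 * e 3 * t + f 4 * t ^ 2) (by fun_prop) fun t => ?_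
    have := hpsd ![1, 0, t]
    rw [h, ha] at this
    simp at this
    linarith
  exact ⟨d, e, f, fun v => by rw [h, ha, hb, hc]; simp [bq, bc, bt]⟩

/-- second difference in direction `E0` -/
def SD (F : (Fin 3 → ℝ) → ℝ) (p : Fin 3 → ℝ) : ℝ := F (p + E0) + F (p - E0) - 2 * F p

lemma SD_shape {F : (Fin 3 → ℝ) → ℝ} {d e f}
    (h : ∀ v, F v = v 0 ^ 2 * bq d (v 1) (v 2) + 2 * v 0 * bc e (v 1) (v 2)
      + bt f (v 1) (v 2)) (p) : SD F p = 2 * bq d (p 1) (p 2) := by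
  simp only [SD, h]
  simp [E0]
  ring

lemma SD_comp {F : (Fin 3 → ℝ) → ℝ} (T : (Fin 3 → ℝ) ≃ₗ[ℝ] (Fin 3 → ℝ)) (hT : T E0 = E0) (p) :
    SD (fun v => F (T v)) p = SD F (T p) := by
  simp [SD, hT]

lemma bq_smul (d) (t y z : ℝ) : bq d (t * y) (t * z) = t ^ 2 * bq d y z := by
  simp [bq]; ring
lemma bc_smul (d) (t y z : ℝ) : bc d (t * y) (t * z) = t ^ 3 * bc d y z := by
  simp [bc]; ring
lemma bt_smul (d) (t y z : ℝ) : bt d (t * y) (t * z) = t ^ 4 * bt d y z := by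
  simp [bt]; ring

lemma bq_cont (d) : Continuous (fun p : ℝ × ℝ => bq d p.1 p.2) := by
  unfold bq; fun_prop
lemma bc_cont (d) : Continuous (fun p : ℝ × ℝ => bc d p.1 p.2) := by
  unfold bc; fun_prop
lemma bt_cont (d) : Continuous (fun p : ℝ × ℝ => bt d p.1 p.2) := by
  unfold bt; fun_prop

/-- quadratic psd, nonzero, dominates a square -/
lemma bq_dom {d : Fin 3 → ℝ} (h : ∀ y z, 0 ≤ bq d y z) (hne : ∃ y z, bq d y z ≠ 0) :
    ∃ m n : ℝ, (m ≠ 0 ∨ n ≠ 0) ∧ ∀ y z, (m * y + n * z) ^ 2 ≤ bq d y z := by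
  have hd0 : 0 ≤ d 0 := by have := h 1 0; simpa [bq] using this
  have hd2 : 0 ≤ d 2 := by have := h 0 1; simpa [bq] using this
  rcases hd0.lt_or_eq with hp | hz
  · refine ⟨√(d 0), d 1 / (2 * √(d 0)), Or.inl (Real.sqrt_pos.2 hp).ne', fun y z => ?_⟩
    have hs : √(d 0) ^ 2 = d 0 := Real.sq_sqrt hd0
    have hs0 : 0 < √(d 0) := Real.sqrt_pos.2 hp
    have e : (√(d 0) * y + d 1 / (2 * √(d 0)) * z) ^ 2
        = d 0 * y ^ 2 + d 1 * (y * z) + d 1 ^ 2 / (4 * d 0) * z ^ 2 := by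
      have : d 1 ^ 2 / (4 * d 0) = (d 1 / (2 * √(d 0))) ^ 2 := by
        rw [div_pow, mul_pow, hs]; norm_num
      rw [this]
      nth_rewrite 3 [← hs]
      field_simp
      ring
    rw [e]
    have h3 : d 1 ^ 2 / (4 * d 0) ≤ d 2 := by
      have := h (- d 1 / (2 * d 0)) 1
      simp only [bq] at this
      have e2 : d 0 * (- d 1 / (2 * d 0)) ^ 2 + d 1 * ((- d 1 / (2 * d 0)) * 1) + d 2 * 1 ^ 2
        = d 2 - d 1 ^ 2 / (4 * d 0) := by field_simp; ring
      rw [e2] at this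
      linarith
    simp only [bq]
    nlinarith [sq_nonneg z]
  · have h1 : d 1 = 0 := by
      refine lin_zero (k := fun t => d 2) (by fun_prop) fun t => ?_
      have := h 1 t
      simp [bq, ← hz] at this
      linarith
    have h2 : 0 < d 2 := by
      rcases hd2.lt_or_eq with hp | hz2
      · exact hp
      · obtain ⟨y, z, hyz⟩ := hne
        exact absurd (by simp [bq, ← hz, h1, ← hz2]) hyz
    refine ⟨0, √(d 2), Or.inr (Real.sqrt_pos.2 h2).ne', fun y z => ?_⟩
    simp [bq, ← hz, h1, mul_pow, Real.sq_sqrt hd2]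

lemma SD_eq_zero_shape {F : (Fin 3 → ℝ) → ℝ} {d e f} (hpsd : ∀ v, 0 ≤ F v)
    (h : ∀ v, F v = v 0 ^ 2 * bq d (v 1) (v 2) + 2 * v 0 * bc e (v 1) (v 2)
      + bt f (v 1) (v 2)) (hS : ∀ p, SD F p = 0) : ∀ v, F v = bt f (v 1) (v 2) := by
  intro v
  have hq : ∀ y z, bq d y z = 0 := fun y z => by
    have := SD_shape h ![0, y, z]
    rw [hS] at this
    simpa using this.symm
  have hc : bc e (v 1) (v 2) = 0 := by
    have := (quad_nonneg (A := bq d (v 1) (v 2)) (B := bc e (v 1) (v 2))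
      (C := bt f (v 1) (v 2)) fun x => by
        have := hpsd ![x, v 1, v 2]
        rw [h] at this
        simpa using this).2.2
    rw [hq] at this
    nlinarith [sq_nonneg (bc e (v 1) (v 2))]
  rw [h, hq, hc]; ring

lemma A0' {F : (Fin 3 → ℝ) → ℝ} {f} (hpsd : ∀ v, 0 ≤ F v)
    (h : ∀ v, F v = bt f (v 1) (v 2)) (hne : ∃ v, F v ≠ 0) (h2 : F E2 = 0) : Dom F := by
  have hf4 : f 4 = 0 := by
    rw [h] at h2; simpa [bt, E2] using h2
  have hf3 : f 3 = 0 := by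
    refine lin_zero (k := fun t => f 2 + f 1 * t + f 0 * t ^ 2) (by fun_prop) fun t => ?_
    have := hpsd ![0, t, 1]
    rw [h] at this
    simp [bt, hf4] at this
    linarith
  have e : ∀ v, F v = v 1 ^ 2 * bq ![f 0, f 1, f 2] (v 1) (v 2) := fun v => by
    rw [h]; simp [bt, bq, hf4, hf3]; ring
  have hp : ∀ y z, 0 ≤ bq ![f 0, f 1, f 2] y z := by
    have h1 : ∀ y z, y ≠ 0 → 0 ≤ bq ![f 0, f 1, f 2] y z := fun y z hy => by
      have := hpsd ![0, y, z]
      rw [e] at this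
      simp only [Matrix.cons_val] at this
      exact nonneg_of_mul_nonneg_right this (by positivity)
    intro y z
    by_cases hy : y = 0
    · subst hy
      exact nonneg_of_pos (g := fun t => bq ![f 0, f 1, f 2] t z) (by unfold bq; fun_prop)
        (fun t ht => h1 t z ht.ne')
    · exact h1 y z hy
  obtain ⟨m, n, hmn, hd⟩ := bq_dom hp (by
    obtain ⟨v, hv⟩ := hne
    rw [e] at hv
    exact ⟨v 1, v 2, fun h => hv (by rw [h, mul_zero])⟩)
  have eq : ∀ v, qf ![0, m, 0, n, 0, 0] v = v 1 * (m * v 1 + n * v 2) := fun v => by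
    simp [qf]; ring
  refine ⟨![0, m, 0, n, 0, 0], ?_, fun v => ?_⟩
  · by_contra hcon
    push Not at hcon
    have h1 := hcon ![0, 1, 0]
    have h2 := hcon ![0, 1, 1]
    rw [eq] at h1 h2
    simp at h1 h2
    rw [h1] at h2
    simp at h2
    tauto
  · rw [eq, e, mul_pow]
    have := hd (v 1) (v 2)
    have := sq_nonneg (v 1)
    gcongr

lemma indep_E0 {p : Fin 3 → ℝ} (hp : p 1 ≠ 0 ∨ p 2 ≠ 0) : LinearIndependent ℝ ![E0, p] := by
  have h0 : E0 ≠ 0 := fun h => by have := congrFun h 0; simp [E0] at this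
  refine (LinearIndependent.pair_iff' h0).2 fun a ha => ?_
  subst ha
  simp [E0] at hp

lemma exists_T {u v : Fin 3 → ℝ} (h : LinearIndependent ℝ ![u, v]) :
    ∃ T : (Fin 3 → ℝ) ≃ₗ[ℝ] (Fin 3 → ℝ), T E0 = u ∧ T E2 = v := by
  obtain ⟨w, hw⟩ := exists_indep3 h
  obtain ⟨T, hT⟩ := exists_equiv3 hw
  let P : (Fin 3 → ℝ) ≃ₗ[ℝ] (Fin 3 → ℝ) := LinearEquiv.funCongrLeft ℝ ℝ (Equiv.swap 0 1)
  refine ⟨P.trans T, ?_, ?_⟩ <;>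
  simp [P, hT, E0, E2, LinearEquiv.funCongrLeft, LinearMap.funLeft]

lemma exists_T' {u v : Fin 3 → ℝ} (h : LinearIndependent ℝ ![u, v]) :
    ∃ T : (Fin 3 → ℝ) ≃ₗ[ℝ] (Fin 3 → ℝ), T E0 = u ∧ T E1 = v := by
  obtain ⟨T, h1, h2⟩ := exists_T h
  let P : (Fin 3 → ℝ) ≃ₗ[ℝ] (Fin 3 → ℝ) := LinearEquiv.funCongrLeft ℝ ℝ (Equiv.swap 1 2)
  refine ⟨P.trans T, ?_, ?_⟩
  · rw [← h1, LinearEquiv.trans_apply]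
    congr 1
    ext i; fin_cases i <;> simp [P, E0, LinearEquiv.funCongrLeft, LinearMap.funLeft]
    rw [Equiv.swap_apply_of_ne_of_ne] <;> simp
  · rw [← h2, LinearEquiv.trans_apply]
    congr 1
    ext i; fin_cases i <;> simp [P, E1, E2, LinearEquiv.funCongrLeft, LinearMap.funLeft]
    rw [Equiv.swap_apply_of_ne_of_ne] <;> simp

lemma A0 {F : (Fin 3 → ℝ) → ℝ} (hF : IsForm 4 F) (hpsd : ∀ v, 0 ≤ F v) (h0 : F E0 = 0)
    (hS : ∀ p, SD F p = 0) (hne : ∃ v, F v ≠ 0) : Dom F := by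
  obtain ⟨d, e, f, h⟩ := shape hF hpsd h0
  have hs := SD_eq_zero_shape hpsd h hS
  by_cases hz : ∃ p : ℝ × ℝ, p ≠ 0 ∧ bt f p.1 p.2 = 0
  · obtain ⟨⟨b, c⟩, hp, hz⟩ := hz
    have hbc : b ≠ 0 ∨ c ≠ 0 := by
      by_contra hcon; push Not at hcon; exact hp (by rw [hcon.1, hcon.2]; rfl)
    obtain ⟨T, hT0, hT2⟩ := exists_T (indep_E0 (p := ![0, b, c]) (by simpa using hbc))
    apply Dom.of_comp T
    have hF' := hF.comp T.toLinearMap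
    obtain ⟨d', e', f', h'⟩ := shape (F := fun v => F (T v)) hF' (fun v => hpsd _)
      (by simp [hT0, h0])
    have hs' := SD_eq_zero_shape (fun v => hpsd (T v)) h' (fun p => by rw [SD_comp T hT0, hS])
    refine A0' (fun v => hpsd (T v)) hs' ?_ ?_
    · obtain ⟨v, hv⟩ := hne
      exact ⟨T.symm v, by simpa using hv⟩
    · simp only [hT2]
      rw [hs]; simpa using hz
  · push Not at hz
    have hpos : ∀ p : ℝ × ℝ, p ≠ 0 → 0 < bt f p.1 p.2 := fun p hp => by
      have := hpsd ![0, p.1, p.2]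
      rw [hs] at this
      simp at this
      exact lt_of_le_of_ne this (hz p hp).symm
    obtain ⟨μ, hμ, hcmp⟩ := compact_compare (φ := fun p : ℝ × ℝ => bt f p.1 p.2)
      (ψ := fun p => p.1 ^ 4) (bt_cont f) (by fun_prop) 4
      (fun t v => by simp [bt_smul]) (fun t v => by simp; ring) hpos (by norm_num)
    refine ⟨![0, √μ, 0, 0, 0, 0], ⟨E1, by simp [qf, E1, (Real.sqrt_pos.2 hμ).ne']⟩, fun v => ?_⟩
    rw [hs]
    have := hcmp (v 1, v 2)
    have e2 : qf ![0, √μ, 0, 0, 0, 0] v ^ 2 = μ * v 1 ^ 4 := by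
      simp only [qf, Matrix.cons_val]
      linear_combination v 1 ^ 4 * Real.sq_sqrt hμ.le
    rw [e2]; exact this

/-- the rank one case -/
lemma A1' {F : (Fin 3 → ℝ) → ℝ} {d e f} (hpsd : ∀ v, 0 ≤ F v)
    (h : ∀ v, F v = v 0 ^ 2 * bq d (v 1) (v 2) + 2 * v 0 * bc e (v 1) (v 2)
      + bt f (v 1) (v 2)) (hd2 : d 2 = 0) (hne : ∃ y z, bq d y z ≠ 0) : Dom F := by
  have hq : ∀ y z, 0 ≤ bq d y z ∧ 0 ≤ bt f y z ∧ bc e y z ^ 2 ≤ bq d y z * bt f y z :=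
    fun y z => quad_nonneg fun x => by
      have := hpsd ![x, y, z]
      rw [h] at this
      simpa using this
  have hd1 : d 1 = 0 := by
    refine lin_zero (k := fun t => d 0) (by fun_prop) fun t => ?_
    have := (hq t 1).1
    simp [bq, hd2] at this
    linarith
  have hd0 : 0 < d 0 := by
    have := (hq 1 0).1
    simp [bq] at this
    rcases this.lt_or_eq with hp | hz
    · exact hp
    · obtain ⟨y, z, hyz⟩ := hne
      exact absurd (by simp [bq, ← hz, hd1, hd2]) hyz
  have he3 : e 3 = 0 := by
    have := (hq 0 1).2.2
    simp [bq, bc, hd2] at this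
    exact this
  have ebc : ∀ y z, bc e y z = y * bq ![e 0, e 1, e 2] y z := fun y z => by
    simp [bc, bq, he3]; ring
  have ebq : ∀ y z, bq d y z = d 0 * y ^ 2 := fun y z => by simp [bq, hd1, hd2]
  have key : ∀ y z, 0 ≤ d 0 * bt f y z - bq ![e 0, e 1, e 2] y z ^ 2 := by
    have h1 : ∀ y z, y ≠ 0 → 0 ≤ d 0 * bt f y z - bq ![e 0, e 1, e 2] y z ^ 2 := fun y z hy => by
      have := (hq y z).2.2
      rw [ebc, ebq] at this
      have hy2 : 0 < y ^ 2 := by positivity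
      by_contra hcon
      push Not at hcon
      nlinarith
    intro y z
    by_cases hy : y = 0
    · subst hy
      exact nonneg_of_pos (g := fun t => d 0 * bt f t z - bq ![e 0, e 1, e 2] t z ^ 2)
        (by unfold bq bt; fun_prop) (fun t ht => h1 t z ht.ne')
    · exact h1 y z hy
  have hs : √(d 0) ^ 2 = d 0 := Real.sq_sqrt hd0.le
  have hs0 : 0 < √(d 0) := Real.sqrt_pos.2 hd0
  set s := √(d 0)
  refine ⟨![0, e 0 / s, e 2 / s, e 1 / s, 0, s], ?_, fun v => ?_⟩
  · by_contra hcon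
    push Not at hcon
    have h1 := hcon ![0, 1, 0]
    have h2 := hcon ![1, 1, 0]
    simp [qf] at h1 h2
    rcases h1 with h1 | h1
    · rw [h1] at h2; simp at h2; linarith
    · linarith
  · have e1 : qf ![0, e 0 / s, e 2 / s, e 1 / s, 0, s] v
        = s * v 0 * v 1 + bq ![e 0, e 1, e 2] (v 1) (v 2) / s := by
      simp [qf, bq]; ring
    rw [e1, h, ebc, ebq]
    have := key (v 1) (v 2)
    generalize bq ![e 0, e 1, e 2] (v 1) (v 2) = B at *
    generalize bt f (v 1) (v 2) = Q at *
    have e2 : (s * v 0 * v 1 + B / s) ^ 2 = d 0 * (v 0 * v 1) ^ 2 + 2 * v 0 * v 1 * B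
        + B ^ 2 / d 0 := by
      rw [← hs]; field_simp; ring
    rw [e2]
    have : B ^ 2 / d 0 ≤ Q := by rw [div_le_iff₀ hd0]; linarith
    nlinarith

lemma A1 {F : (Fin 3 → ℝ) → ℝ} (hF : IsForm 4 F) (hpsd : ∀ v, 0 ≤ F v) (h0 : F E0 = 0)
    {p : Fin 3 → ℝ} (hp : p 1 ≠ 0 ∨ p 2 ≠ 0) (hS : SD F p = 0) (hne : ∃ v, F v ≠ 0) :
    Dom F := by
  by_cases hS' : ∀ p, SD F p = 0
  · exact A0 hF hpsd h0 hS' hne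
  push Not at hS'
  obtain ⟨r, hr⟩ := hS'
  obtain ⟨T, hT0, hT2⟩ := exists_T (indep_E0 hp)
  apply Dom.of_comp T
  have hF' := hF.comp T.toLinearMap
  obtain ⟨d, e, f, h⟩ := shape (F := fun v => F (T v)) hF' (fun v => hpsd _) (by simp [hT0, h0])
  refine A1' (fun v => hpsd (T v)) h ?_ ?_
  · have := SD_shape h E2
    rw [SD_comp T hT0, hT2, hS] at this
    simpa [E2, bq] using this.symm
  · have := SD_shape h (T.symm r)
    rw [SD_comp T hT0] at this
    simp at this
    exact ⟨_, _, fun h => hr (by rw [this, h, mul_zero])⟩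

/-- factor of a binary quadratic with a zero -/
lemma bq_factor {g : Fin 3 → ℝ} {b c : ℝ} (hbc : b ≠ 0 ∨ c ≠ 0) (h : bq g b c = 0) :
    ∃ m n, ∀ y z, bq g y z = (c * y - b * z) * (m * y + n * z) := by
  by_cases hc : c = 0
  · subst hc
    have hb : b ≠ 0 := by simpa using hbc
    have hg : g 0 = 0 := by simpa [bq, hb] using h
    refine ⟨-g 1 / b, -g 2 / b, fun y z => ?_⟩
    simp [bq, hg]; field_simp; ring
  · refine ⟨g 0 / c, (g 0 * b / c + g 1) / c, fun y z => ?_⟩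
    have hg : g 2 = -(g 0 * b ^ 2 + g 1 * (b * c)) / c ^ 2 := by
      rw [eq_div_iff (by positivity)]; simp [bq] at h; linarith
    simp only [bq, hg]; field_simp; ring

lemma caseB {F : (Fin 3 → ℝ) → ℝ} (hF : IsForm 4 F) (hpsd : ∀ v, 0 ≤ F v) (h0 : F E0 = 0)
    (h1 : F E1 = 0) (hne : ∃ v, F v ≠ 0) : Dom F := by
  by_cases hS : ∃ p : Fin 3 → ℝ, (p 1 ≠ 0 ∨ p 2 ≠ 0) ∧ SD F p = 0
  · obtain ⟨p, hp, hS⟩ := hS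
    exact A1 hF hpsd h0 hp hS hne
  push Not at hS
  obtain ⟨d, e, f, h⟩ := shape hF hpsd h0
  have hq : ∀ y z, 0 ≤ bq d y z ∧ 0 ≤ bt f y z ∧ bc e y z ^ 2 ≤ bq d y z * bt f y z :=
    fun y z => quad_nonneg fun x => by
      have := hpsd ![x, y, z]
      rw [h] at this
      simpa using this
  have hpos : ∀ y z, (y ≠ 0 ∨ z ≠ 0) → 0 < bq d y z := fun y z hyz => by
    refine lt_of_le_of_ne (hq y z).1 fun h' => ?_
    have := hS ![0, y, z] (by simpa using hyz)
    rw [SD_shape h] at this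
    simp [← h'] at this
  have hf0 : f 0 = 0 := by
    rw [h] at h1; simpa [E1, bt] using h1
  have hf1 : f 1 = 0 := by
    refine lin_zero (k := fun t => f 2 + f 3 * t + f 4 * t ^ 2) (by fun_prop) fun t => ?_
    have := (hq 1 t).2.1
    simp [bt, hf0] at this
    linarith
  have he0 : e 0 = 0 := by
    have := (hq 1 0).2.2
    simp [bt, hf0, bc] at this
    exact this
  set g : Fin 3 → ℝ := ![e 1, e 2, e 3] with hg
  set k : Fin 3 → ℝ := ![f 2, f 3, f 4] with hk
  have ebc : ∀ y z, bc e y z = z * bq g y z := fun y z => by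
    simp [bc, bq, he0, hg]; ring
  have ebt : ∀ y z, bt f y z = z ^ 2 * bq k y z := fun y z => by
    simp [bt, bq, hf0, hf1, hk]; ring
  have hD : ∀ y z, 0 ≤ bq d y z * bq k y z - bq g y z ^ 2 := by
    have h1 : ∀ y z, z ≠ 0 → 0 ≤ bq d y z * bq k y z - bq g y z ^ 2 := fun y z hz => by
      have := (hq y z).2.2
      rw [ebc, ebt] at this
      have hz2 : 0 < z ^ 2 := by positivity
      by_contra hcon
      push Not at hcon
      nlinarith
    intro y z
    by_cases hz : z = 0
    · subst hz
      exact nonneg_of_pos (g := fun t => bq d y t * bq k y t - bq g y t ^ 2)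
        (by unfold bq; fun_prop) (fun t ht => h1 y t ht.ne')
    · exact h1 y z hz
  by_cases hz : ∃ p : ℝ × ℝ, p ≠ 0 ∧ bq d p.1 p.2 * bq k p.1 p.2 - bq g p.1 p.2 ^ 2 = 0
  · obtain ⟨⟨b, c⟩, hp, hz⟩ := hz
    have hbc : b ≠ 0 ∨ c ≠ 0 := by
      by_contra hcon; push Not at hcon; exact hp (by rw [hcon.1, hcon.2]; rfl)
    simp only at hz
    have hdbc := hpos b c hbc
    set N := - bq g b c / bq d b c with hN
    have eN : bq g b c + N * bq d b c = 0 := by rw [hN]; field_simp; ring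
    set G : Fin 3 → ℝ := fun i => g i + N * d i with hG
    set H : Fin 3 → ℝ := fun i => k i + 2 * N * g i + N ^ 2 * d i with hH
    have eG : ∀ y z, bq G y z = bq g y z + N * bq d y z := fun y z => by
      simp only [bq, hG]; ring
    have eH : ∀ y z, bq H y z = bq k y z + 2 * N * bq g y z + N ^ 2 * bq d y z := fun y z => by
      simp only [bq, hH]; ring
    have hD' : ∀ y z, 0 ≤ bq d y z * bq H y z - bq G y z ^ 2 := fun y z => by
      have := hD y z
      rw [eG, eH]; linarith
    have hGz : bq G b c = 0 := by rw [eG, eN]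
    have hHz : bq H b c = 0 := by
      have : bq d b c * bq H b c = 0 := by
        have e1 : bq d b c * bq H b c - bq G b c ^ 2 = 0 := by rw [← hz, eG, eH]; ring
        rw [hGz] at e1; linarith
      rcases mul_eq_zero.1 this with h | h
      · linarith
      · exact h
    have hHp : ∀ y z, 0 ≤ bq H y z := fun y z => by
      by_cases hyz : y ≠ 0 ∨ z ≠ 0
      · have h1 := hpos y z hyz
        have h2 := hD' y z
        by_contra hcon
        push Not at hcon
        nlinarith [sq_nonneg (bq G y z)]
      · push Not at hyz
        rw [hyz.1, hyz.2]; simp [bq]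
    have eF : ∀ v, F v = (v 0 - N * v 2) ^ 2 * bq d (v 1) (v 2)
        + 2 * (v 0 - N * v 2) * v 2 * bq G (v 1) (v 2) + v 2 ^ 2 * bq H (v 1) (v 2) := fun v => by
      rw [h, ebc, ebt, eG, eH]; ring
    by_cases hH0 : ∃ y z, bq H y z ≠ 0
    · obtain ⟨m, n, hmn⟩ := bq_factor hbc hHz
      obtain ⟨m', n', hmn'⟩ := bq_factor hbc hGz
      -- `m y + n z = a (c y - b z)`
      have hp2 : 0 < b ^ 2 + c ^ 2 := by
        rcases hbc with h | h <;> positivity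
      have hmb : m * b + n * c = 0 := by
        refine lin_zero (s := m * b + n * c) (k := fun t => (b ^ 2 + c ^ 2)⁻¹ * (m * c - n * b))
          (by fun_prop) fun t => ?_
        have := hHp (b + t * (c / (b ^ 2 + c ^ 2))) (c - t * (b / (b ^ 2 + c ^ 2)))
        rw [hmn] at this
        have e1 : (c * (b + t * (c / (b ^ 2 + c ^ 2))) - b * (c - t * (b / (b ^ 2 + c ^ 2)))) = t := by
          field_simp; ring
        rw [e1] at this
        have e2 : (m * b + n * c) * t + t ^ 2 * ((b ^ 2 + c ^ 2)⁻¹ * (m * c - n * b))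
          = t * (m * (b + t * (c / (b ^ 2 + c ^ 2))) + n * (c - t * (b / (b ^ 2 + c ^ 2)))) := by
          field_simp; ring
        rw [e2]; exact this
      set a := (m * c - n * b) / (b ^ 2 + c ^ 2) with ha
      have hm : m = a * c := by
        rw [ha]; field_simp; linear_combination b * hmb
      have hn : n = - a * b := by
        rw [ha]; field_simp; linear_combination c * hmb
      have eH2 : ∀ y z, bq H y z = a * (c * y - b * z) ^ 2 := fun y z => by
        rw [hmn, hm, hn]; ring
      have ha0 : 0 < a := by
        obtain ⟨y, z, hyz⟩ := hH0
        have h1 := hHp y z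
        rw [eH2] at h1 hyz
        by_contra hcon
        push Not at hcon
        have : a * (c * y - b * z) ^ 2 ≤ 0 := mul_nonpos_of_nonpos_of_nonneg hcon (sq_nonneg _)
        exact hyz (le_antisymm this h1)
      have hl : ∀ y z, 0 ≤ a * bq d y z - (m' * y + n' * z) ^ 2 := by
        have h1 : ∀ y z, c * y - b * z ≠ 0 → 0 ≤ a * bq d y z - (m' * y + n' * z) ^ 2 := by
          intro y z hyz
          have := hD' y z
          rw [eH2, hmn'] at this
          have h2 : 0 < (c * y - b * z) ^ 2 := by positivity
          by_contra hcon
          push Not at hcon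
          nlinarith
        intro y z
        by_cases hyz : c * y - b * z = 0
        · have := nonneg_of_pos (g := fun t => a * bq d (y + t * c) (z - t * b)
            - (m' * (y + t * c) + n' * (z - t * b)) ^ 2) (by unfold bq; fun_prop)
            (fun t ht => h1 _ _ (by
              have : c * (y + t * c) - b * (z - t * b) = t * (b ^ 2 + c ^ 2) := by
                linear_combination hyz
              rw [this]; positivity))
          simpa using this
        · exact h1 y z hyz
      have hs : √a ^ 2 = a := Real.sq_sqrt ha0.le
      have hs0 : 0 < √a := Real.sqrt_pos.2 ha0
      set s := √a
      let C : Fin 6 → ℝ := ![0, 0, -s * b - N * n' / s, s * c - N * m' / s, n' / s, m' / s]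
      have eC : ∀ v, qf C v = s * v 2 * (c * v 1 - b * v 2)
          + (v 0 - N * v 2) * (m' * v 1 + n' * v 2) / s := fun v => by
        simp [qf, C]; field_simp; ring
      refine ⟨C, ?_, fun v => ?_⟩
      · by_contra hcon
        push Not at hcon
        have h1 := hcon ![-(N * b), c, -b]
        have h2 := hcon ![N * (c - b), b + c, c - b]
        rw [eC] at h1 h2
        simp only [Matrix.cons_val] at h1 h2
        have e1 : b * (s * (b ^ 2 + c ^ 2)) = 0 := by linear_combination -h1
        have e2 : (c - b) * (s * (b ^ 2 + c ^ 2)) = 0 := by linear_combination h2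
        have hpp : s * (b ^ 2 + c ^ 2) ≠ 0 := by positivity
        have hb0 := (mul_eq_zero.1 e1).resolve_right hpp
        have hc0 := (mul_eq_zero.1 e2).resolve_right hpp
        rw [hb0, sub_zero] at hc0
        rw [hb0, hc0] at hp2
        simp at hp2
      · rw [eC, eF, hmn', eH2]
        have h3 := hl (v 1) (v 2)
        generalize v 0 - N * v 2 = x
        generalize c * v 1 - b * v 2 = l
        generalize m' * v 1 + n' * v 2 = l' at *
        generalize bq d (v 1) (v 2) = D at *
        have e1 : (s * v 2 * l + x * l' / s) ^ 2 = a * (v 2 * l) ^ 2 + 2 * x * v 2 * l * l'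
          + x ^ 2 * (l' ^ 2 / a) := by
          rw [← hs]; field_simp; ring
        rw [e1]
        have : l' ^ 2 / a ≤ D := by rw [div_le_iff₀ ha0]; linarith
        nlinarith [sq_nonneg x]
    · push Not at hH0
      have hG0 : ∀ y z, bq G y z = 0 := fun y z => by
        have := hD' y z
        rw [hH0] at this
        nlinarith [sq_nonneg (bq G y z)]
      obtain ⟨μ, hμ, hcmp⟩ := compact_compare (φ := fun p : ℝ × ℝ => bq d p.1 p.2)
        (ψ := fun p => p.1 ^ 2) (bq_cont d) (by fun_prop) 2
        (fun t v => by simp [bq_smul]) (fun t v => by simp; ring) (fun p hp => hpos _ _ (by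
          by_contra hcon; push Not at hcon; exact hp (Prod.ext hcon.1 hcon.2))) (by norm_num)
      have eC : ∀ v, qf ![0, 0, 0, -√μ * N, 0, √μ] v = √μ * ((v 0 - N * v 2) * v 1) := fun v => by
        simp [qf]; ring
      refine ⟨![0, 0, 0, -√μ * N, 0, √μ], ⟨![1, 1, 0], ?_⟩, fun v => ?_⟩
      · rw [eC]; simp [(Real.sqrt_pos.2 hμ).ne']
      · rw [eC, eF, hG0, hH0, mul_pow, Real.sq_sqrt hμ.le]
        have h3 : μ * v 1 ^ 2 ≤ bq d (v 1) (v 2) := hcmp (v 1, v 2)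
        nlinarith [sq_nonneg (v 0 - N * v 2)]
  · push Not at hz
    obtain ⟨μ, hμ, hcmp⟩ := compact_compare
      (φ := fun p : ℝ × ℝ => bq d p.1 p.2 * bq k p.1 p.2 - bq g p.1 p.2 ^ 2)
      (ψ := fun p => p.2 ^ 2 * bq d p.1 p.2) (by unfold bq; fun_prop) (by unfold bq; fun_prop) 4
      (fun t v => by simp [bq_smul]; ring) (fun t v => by simp [bq_smul]; ring)
      (fun p hp => lt_of_le_of_ne (hD _ _) (hz p hp).symm) (by norm_num)
    have eC : ∀ v, qf ![0, 0, √μ, 0, 0, 0] v = √μ * v 2 ^ 2 := fun v => by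
      simp [qf]
    refine ⟨![0, 0, √μ, 0, 0, 0], ⟨![0, 0, 1], ?_⟩, fun v => ?_⟩
    · rw [eC]; simp [(Real.sqrt_pos.2 hμ).ne']
    · rw [eC, mul_pow, Real.sq_sqrt hμ.le]
      by_cases hyz : v 1 ≠ 0 ∨ v 2 ≠ 0
      · have h1 := hpos _ _ hyz
        have h2 : μ * (v 2 ^ 2 * bq d (v 1) (v 2)) ≤ _ := hcmp (v 1, v 2)
        simp only at h2
        rw [h, ebc, ebt]
        generalize bq d (v 1) (v 2) = D at *
        generalize bq g (v 1) (v 2) = G at *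
        generalize bq k (v 1) (v 2) = K at *
        have : 0 ≤ D * (v 0 ^ 2 * D + 2 * v 0 * (v 2 * G) + v 2 ^ 2 * K - μ * (v 2 ^ 2) ^ 2) := by
          nlinarith [sq_nonneg (v 0 * D + v 2 * G), sq_nonneg (v 2)]
        have := nonneg_of_mul_nonneg_right this h1
        linarith
      · push Not at hyz
        rw [hyz.2]; simpa using hpsd v

lemma caseA {F : (Fin 3 → ℝ) → ℝ} (hF : IsForm 4 F) (hpsd : ∀ v, 0 ≤ F v) (h0 : F E0 = 0)
    (hne : ∃ v, F v ≠ 0) : Dom F := by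
  by_cases hS : ∃ p : Fin 3 → ℝ, (p 1 ≠ 0 ∨ p 2 ≠ 0) ∧ SD F p = 0
  · obtain ⟨p, hp, hS⟩ := hS
    exact A1 hF hpsd h0 hp hS hne
  push Not at hS
  obtain ⟨d, e, f, h⟩ := shape hF hpsd h0
  have hq : ∀ y z, 0 ≤ bq d y z ∧ 0 ≤ bt f y z ∧ bc e y z ^ 2 ≤ bq d y z * bt f y z :=
    fun y z => quad_nonneg fun x => by
      have := hpsd ![x, y, z]
      rw [h] at this
      simpa using this
  have hpos : ∀ y z, (y ≠ 0 ∨ z ≠ 0) → 0 < bq d y z := fun y z hyz => by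
    refine lt_of_le_of_ne (hq y z).1 fun h' => ?_
    have := hS ![0, y, z] (by simpa using hyz)
    rw [SD_shape h] at this
    simp [← h'] at this
  by_cases hz : ∃ p : ℝ × ℝ, p ≠ 0 ∧ bq d p.1 p.2 * bt f p.1 p.2 - bc e p.1 p.2 ^ 2 = 0
  · obtain ⟨⟨b, c⟩, hp, hz⟩ := hz
    have hbc : b ≠ 0 ∨ c ≠ 0 := by
      by_contra hcon; push Not at hcon; exact hp (by rw [hcon.1, hcon.2]; rfl)
    simp only at hz
    have hd := hpos b c hbc
    obtain ⟨T, hT0, hT1⟩ := exists_T' (indep_E0 (p := ![- bc e b c / bq d b c, b, c])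
      (by simpa using hbc))
    apply Dom.of_comp T
    refine caseB (hF.comp T.toLinearMap) (fun v => hpsd _) ?_ ?_ ?_
    · simp [hT0, h0]
    · simp only [LinearEquiv.coe_coe, hT1]
      rw [h]
      simp only [Matrix.cons_val]
      field_simp
      linear_combination hz
    · obtain ⟨v, hv⟩ := hne
      exact ⟨T.symm v, by simpa using hv⟩
  · push Not at hz
    obtain ⟨μ, hμ, hcmp⟩ := compact_compare
      (φ := fun p : ℝ × ℝ => bq d p.1 p.2 * bt f p.1 p.2 - bc e p.1 p.2 ^ 2)
      (ψ := fun p => p.2 ^ 4 * bq d p.1 p.2) (by unfold bq bt bc; fun_prop)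
      (by unfold bq; fun_prop) 6
      (fun t v => by simp [bq_smul, bt_smul, bc_smul]; ring)
      (fun t v => by simp [bq_smul]; ring)
      (fun p hp => lt_of_le_of_ne (by have := (hq p.1 p.2).2.2; linarith) (hz p hp).symm)
      (by norm_num)
    have eC : ∀ v, qf ![0, 0, √μ, 0, 0, 0] v = √μ * v 2 ^ 2 := fun v => by
      simp [qf]
    refine ⟨![0, 0, √μ, 0, 0, 0], ⟨![0, 0, 1], ?_⟩, fun v => ?_⟩
    · rw [eC]; simp [(Real.sqrt_pos.2 hμ).ne']
    · rw [eC, mul_pow, Real.sq_sqrt hμ.le]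
      by_cases hyz : v 1 ≠ 0 ∨ v 2 ≠ 0
      · have h1 := hpos _ _ hyz
        have h2 : μ * (v 2 ^ 4 * bq d (v 1) (v 2)) ≤ _ := hcmp (v 1, v 2)
        simp only at h2
        rw [h]
        generalize bq d (v 1) (v 2) = D at *
        generalize bc e (v 1) (v 2) = G at *
        generalize bt f (v 1) (v 2) = K at *
        have : 0 ≤ D * (v 0 ^ 2 * D + 2 * v 0 * G + K - μ * (v 2 ^ 2) ^ 2) := by
          nlinarith [sq_nonneg (v 0 * D + G)]
        have := nonneg_of_mul_nonneg_right this h1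
        linarith
      · push Not at hyz
        rw [hyz.2]; simpa using hpsd v

/-- A nonzero psd ternary quartic dominates a nonzero square. -/
lemma dom_of_psd {F : (Fin 3 → ℝ) → ℝ} (hF : IsForm 4 F) (hpsd : ∀ v, 0 ≤ F v)
    (hne : ∃ v, F v ≠ 0) : Dom F := by
  by_cases hz : ∃ v, v ≠ 0 ∧ F v = 0
  · obtain ⟨u, hu, hz⟩ := hz
    obtain ⟨v, hv⟩ := exists_indep2 hu
    obtain ⟨T, hT0, -⟩ := exists_T hv
    apply Dom.of_comp T
    refine caseA (hF.comp T.toLinearMap) (fun v => hpsd _) ?_ ?_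
    · simp [hT0, hz]
    · obtain ⟨v, hv⟩ := hne
      exact ⟨T.symm v, by simpa using hv⟩
  · push Not at hz
    obtain ⟨μ, hμ, hcmp⟩ := compact_compare (φ := F) (ψ := fun v => v 0 ^ 4)
      hF.continuous (by fun_prop) 4 (fun t v => hF.smul t v) (fun t v => by simp; ring)
      (fun p hp => lt_of_le_of_ne (hpsd p) (hz p hp).symm) (by norm_num)
    refine ⟨![√μ, 0, 0, 0, 0, 0], ⟨E0, by simp [qf, E0, (Real.sqrt_pos.2 hμ).ne']⟩, fun v => ?_⟩
    have := hcmp v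
    have e2 : qf ![√μ, 0, 0, 0, 0, 0] v ^ 2 = μ * v 0 ^ 4 := by
      simp only [qf, Matrix.cons_val]
      linear_combination v 0 ^ 4 * Real.sq_sqrt hμ.le
    rw [e2]; exact this

/-- monomials of degree two -/
def mon (v : Fin 3 → ℝ) : Fin 6 → ℝ :=
  ![v 0 ^ 2, v 1 ^ 2, v 2 ^ 2, v 1 * v 2, v 0 * v 2, v 0 * v 1]

lemma qf_eq_dot (c : Fin 6 → ℝ) (v) : qf c v = c ⬝ᵥ mon v := by
  simp [qf, mon, dotProduct, Fin.sum_univ_six]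

lemma sum_sq_eq {n : ℕ} (B : Matrix (Fin n) (Fin 6) ℝ) (v) :
    ∑ i, qf (B i) v ^ 2 = mon v ⬝ᵥ ((B.transpose * B).mulVec (mon v)) := by
  rw [← Matrix.mulVec_mulVec, Matrix.dotProduct_mulVec, Matrix.vecMul_transpose]
  simp only [dotProduct, Matrix.mulVec]
  refine Finset.sum_congr rfl fun i _ => ?_
  rw [qf_eq_dot, sq]; rfl

open scoped MatrixOrder Matrix.Norms.L2Operator in
lemma reduce_six {n : ℕ} (B : Matrix (Fin n) (Fin 6) ℝ) :
    ∃ B' : Matrix (Fin 6) (Fin 6) ℝ, ∀ v, ∑ i, qf (B i) v ^ 2 = ∑ i, qf (B' i) v ^ 2 := by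
  have h : (B.transpose * B).PosSemidef := by
    have := Matrix.posSemidef_conjTranspose_mul_self B
    simpa using this
  obtain ⟨B', hB'⟩ := CStarAlgebra.nonneg_iff_eq_star_mul_self.mp h.nonneg
  refine ⟨B', fun v => ?_⟩
  rw [sum_sq_eq, sum_sq_eq, hB', Matrix.star_eq_conjTranspose]
  simp

/-- six test points -/
def pts : Fin 6 → Fin 3 → ℝ :=
  ![![1, 0, 0], ![0, 1, 0], ![0, 0, 1], ![0, 1, 1], ![1, 0, 1], ![1, 1, 0]]

lemma qf_coef (c : Fin 6 → ℝ) : c 0 = qf c (pts 0) ∧ c 1 = qf c (pts 1) ∧ c 2 = qf c (pts 2) ∧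
    c 3 = qf c (pts 3) - qf c (pts 1) - qf c (pts 2) ∧
    c 4 = qf c (pts 4) - qf c (pts 0) - qf c (pts 2) ∧
    c 5 = qf c (pts 5) - qf c (pts 0) - qf c (pts 1) := by
  simp [qf, pts]
  refine ⟨by ring, by ring, by ring⟩

lemma qf_bound {c : Fin 6 → ℝ} {R : ℝ} (h : ∀ k, |qf c (pts k)| ≤ R) (j) : |c j| ≤ 3 * R := by
  obtain ⟨h0, h1, h2, h3, h4, h5⟩ := qf_coef c
  have a0 := abs_le.1 (h 0)
  have a1 := abs_le.1 (h 1)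
  have a2 := abs_le.1 (h 2)
  have a3 := abs_le.1 (h 3)
  have a4 := abs_le.1 (h 4)
  have a5 := abs_le.1 (h 5)
  rw [abs_le]
  fin_cases j <;> simp only [Fin.zero_eta, Fin.mk_one, Fin.reduceFinMk] <;> constructor <;> linarith

lemma qf_cont_c (v) : Continuous (fun c : Fin 6 → ℝ => qf c v) := by
  unfold qf; fun_prop

/-- Hilbert's theorem on ternary quartics -/
theorem hilbert {F : (Fin 3 → ℝ) → ℝ} (hF : IsForm 4 F) (hpsd : ∀ v, 0 ≤ F v) :
    ∃ c : Fin 6 → Fin 6 → ℝ, ∀ v, F v = ∑ i, qf (c i) v ^ 2 := by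
  let K : Set (Fin 6 → Fin 6 → ℝ) := {c | ∀ v, ∑ i, qf (c i) v ^ 2 ≤ F v}
  let L : (Fin 6 → Fin 6 → ℝ) → ℝ := fun c => ∑ k, ∑ i, qf (c i) (pts k) ^ 2
  have hcont : ∀ v, Continuous fun c : Fin 6 → Fin 6 → ℝ => ∑ i, qf (c i) v ^ 2 := fun v =>
    continuous_finsetSum _ fun i _ => ((qf_cont_c v).comp (continuous_apply i)).pow 2
  have hL : Continuous L := continuous_finsetSum _ fun k _ => hcont (pts k)
  have hKc : IsClosed K := by
    have : K = ⋂ v, {c | ∑ i, qf (c i) v ^ 2 ≤ F v} := by ext c; simp [K]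
    rw [this]
    exact isClosed_iInter fun v => isClosed_le (hcont v) continuous_const
  have hKb : Bornology.IsBounded K := by
    set R := 1 + ∑ k, F (pts k) with hR
    have hS : 0 ≤ ∑ k, F (pts k) := Finset.sum_nonneg fun k _ => hpsd _
    refine (Metric.isBounded_iff_subset_closedBall 0).2 ⟨3 * R, fun c hc => ?_⟩
    rw [mem_closedBall_zero_iff, pi_norm_le_iff_of_nonneg (by positivity)]
    intro i
    rw [pi_norm_le_iff_of_nonneg (by positivity)]
    intro j
    refine qf_bound (fun k => ?_) j
    have h1 : qf (c i) (pts k) ^ 2 ≤ ∑ k, F (pts k) :=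
      calc qf (c i) (pts k) ^ 2 ≤ ∑ i, qf (c i) (pts k) ^ 2 :=
            Finset.single_le_sum (f := fun i => qf (c i) (pts k) ^ 2)
              (fun i _ => sq_nonneg _) (Finset.mem_univ i)
        _ ≤ F (pts k) := hc _
        _ ≤ _ := Finset.single_le_sum (f := fun k => F (pts k)) (fun i _ => hpsd _)
            (Finset.mem_univ k)
    refine abs_le_of_sq_le_sq (by nlinarith) (by positivity)
  have hKn : K.Nonempty := ⟨0, fun v => by simpa [qf] using hpsd v⟩
  obtain ⟨c, hcK, hcmax⟩ := (Metric.isCompact_of_isClosed_isBounded hKc hKb).exists_isMaxOn hKn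
    hL.continuousOn
  refine ⟨c, ?_⟩
  by_contra hcon
  push Not at hcon
  have hG : IsForm 4 (fun v => F v - ∑ i, qf (c i) v ^ 2) := by
    refine hF.sub ⟨∑ i, (qp (c i)) ^ 2, IsHomogeneous.sum _ _ _ fun i _ => ?_, fun v => ?_⟩
    · exact (qp_homog (c i)).pow 2
    · simp [eval_qp]
  obtain ⟨q, ⟨w, hw⟩, hq⟩ := dom_of_psd hG (fun v => sub_nonneg.2 (hcK v)) (by
    obtain ⟨v, hv⟩ := hcon
    exact ⟨v, sub_ne_zero.2 hv⟩)
  obtain ⟨c', hc'⟩ := reduce_six (n := 7) (Matrix.of (Fin.cons q c))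
  have e : ∀ v, ∑ i, qf (c' i) v ^ 2 = qf q v ^ 2 + ∑ i, qf (c i) v ^ 2 := fun v => by
    rw [← hc', Fin.sum_univ_succ]; rfl
  have hc'K : c' ∈ K := fun v => by rw [e]; have := hq v; linarith
  have h1 : L c' ≤ L c := hcmax hc'K
  have h2 : L c' = ∑ k, qf q (pts k) ^ 2 + L c := by
    simp only [L, e, Finset.sum_add_distrib]
  have h3 : ∑ k, qf q (pts k) ^ 2 = 0 :=
    le_antisymm (by linarith) (Finset.sum_nonneg fun k _ => sq_nonneg _)
  rw [Finset.sum_eq_zero_iff_of_nonneg (fun k _ => sq_nonneg _)] at h3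
  have h4 : ∀ j, q j = 0 := fun j => by
    have := qf_bound (c := q) (R := 0) (fun k => by
      have := h3 k (Finset.mem_univ k)
      simp at this
      simp [this]) j
    simpa using this
  exact hw (by simp [qf, h4])

/-- `X i ↦ X i * T` -/
def gradMap : MvPolynomial (Fin 3) ℝ →ₐ[ℝ] Polynomial (MvPolynomial (Fin 3) ℝ) :=
  aeval fun i => Polynomial.C (X i) * Polynomial.X

lemma gradMap_monomial (m : Fin 3 →₀ ℕ) (a : ℝ) :
    gradMap (monomial m a) = Polynomial.monomial m.degree (monomial m a) := by
  rw [gradMap, aeval_monomial, ← Polynomial.C_mul_X_pow_eq_monomial, monomial_eq, Finsupp.prod,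
    Finsupp.prod, Finsupp.degree_apply]
  simp only [mul_pow, Finset.prod_mul_distrib, Finset.prod_pow_eq_pow_sum, map_mul, map_prod,
    map_pow]
  rw [mul_assoc]
  rfl

lemma gradMap_coeff (p : MvPolynomial (Fin 3) ℝ) (n : ℕ) :
    (gradMap p).coeff n = homogeneousComponent n p := by
  induction p using MvPolynomial.induction_on' with
  | monomial m a =>
    rw [gradMap_monomial, Polynomial.coeff_monomial]
    have h := isHomogeneous_monomial (R := ℝ) (d := m) a (n := m.degree) rfl
    rw [homogeneousComponent_of_mem ((mem_homogeneousSubmodule _ _).2 h)]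
    simp [eq_comm]
  | add p q hp hq => simp [hp, hq]

lemma gradMap_eval (p : MvPolynomial (Fin 3) ℝ) : (gradMap p).eval 1 = p := by
  induction p using MvPolynomial.induction_on' with
  | monomial m a => rw [gradMap_monomial]; simp
  | add p q hp hq => simp [hp, hq]

lemma gradMap_ne {p : MvPolynomial (Fin 3) ℝ} (h : p ≠ 0) : gradMap p ≠ 0 := by
  intro h0; apply h; rw [← gradMap_eval p, h0]; simp

lemma gradMap_homog {p : MvPolynomial (Fin 3) ℝ} {d} (h : p.IsHomogeneous d) :
    gradMap p = Polynomial.monomial d p := by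
  ext1 n
  rw [gradMap_coeff, Polynomial.coeff_monomial,
    homogeneousComponent_of_mem ((mem_homogeneousSubmodule _ _).2 h)]
  simp [eq_comm]

lemma factor_homog {p q : MvPolynomial (Fin 3) ℝ} {d} (h : (p * q).IsHomogeneous d)
    (h0 : p * q ≠ 0) : ∃ n, p.IsHomogeneous n := by
  have hp := gradMap_ne (left_ne_zero_of_mul h0)
  have hq := gradMap_ne (right_ne_zero_of_mul h0)
  have e : gradMap p * gradMap q = Polynomial.monomial d (p * q) := by
    rw [← map_mul, gradMap_homog h]
  have e1 := Polynomial.natDegree_mul hp hq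
  have e2 := Polynomial.natTrailingDegree_mul hp hq
  rw [e, Polynomial.natDegree_monomial_eq _ h0] at e1
  rw [e, Polynomial.natTrailingDegree_monomial h0] at e2
  have l1 := Polynomial.natTrailingDegree_le_natDegree (gradMap p)
  have l2 := Polynomial.natTrailingDegree_le_natDegree (gradMap q)
  have l3 : (gradMap p).natTrailingDegree = (gradMap p).natDegree := by omega
  refine ⟨(gradMap p).natDegree, ?_⟩
  have : gradMap p = Polynomial.monomial (gradMap p).natDegree
      ((gradMap p).coeff (gradMap p).natDegree) := by
    ext1 n
    rw [Polynomial.coeff_monomial]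
    split_ifs with hn
    · rw [hn]
    · rcases lt_or_gt_of_ne hn with h | h
      · exact Polynomial.coeff_eq_zero_of_natDegree_lt h
      · exact Polynomial.coeff_eq_zero_of_lt_natTrailingDegree (l3 ▸ h)
  have h2 := gradMap_eval p
  rw [this, gradMap_coeff] at h2
  simp only [Polynomial.eval_monomial, one_pow, mul_one] at h2
  have := homogeneousComponent_isHomogeneous (gradMap p).natDegree p
  rwa [h2] at this

/-- Bezout over a fraction field. -/
lemma bezout {R : Type} [CommRing R] [IsDomain R] [UniqueFactorizationMonoid R]
    {p q : Polynomial R} (hp : Irreducible p) (hd : p.natDegree ≠ 0) (hn : ¬ p ∣ q) :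
    ∃ a b : Polynomial R, ∃ r : R, r ≠ 0 ∧ a * p + b * q = Polynomial.C r := by
  let K := FractionRing R
  have hprim := hp.isPrimitive hd
  have hi : Irreducible (Polynomial.map (algebraMap R K) p) :=
    hprim.irreducible_iff_irreducible_map_fraction_map.1 hp
  have hn' : ¬ Polynomial.map (algebraMap R K) p ∣ Polynomial.map (algebraMap R K) q := fun h =>
    hn (hprim.dvd_of_fraction_map_dvd_fraction_map h)
  obtain ⟨a, b, hab⟩ := hi.coprime_iff_not_dvd.2 hn'
  obtain ⟨s, hs, ha⟩ := IsLocalization.integerNormalization_spec (nonZeroDivisors R) a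
  obtain ⟨t, ht, hb⟩ := IsLocalization.integerNormalization_spec (nonZeroDivisors R) b
  refine ⟨Polynomial.C t * IsLocalization.integerNormalization (nonZeroDivisors R) a,
    Polynomial.C s * IsLocalization.integerNormalization (nonZeroDivisors R) b, s * t,
    mul_ne_zero (nonZeroDivisors.ne_zero hs) (nonZeroDivisors.ne_zero ht), ?_⟩
  apply Polynomial.map_injective (algebraMap R K) (IsFractionRing.injective R K)
  simp only [Polynomial.map_add, Polynomial.map_mul, ha, hb, Polynomial.map_C, Algebra.smul_def,
    Polynomial.algebraMap_apply, map_mul]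
  have : ∀ x, algebraMap R (Polynomial K) x = Polynomial.C (algebraMap R K x) := fun x => rfl
  linear_combination (Polynomial.C (algebraMap R K s) * Polynomial.C (algebraMap R K t)) * hab

lemma common_zero {p q : ℝ → ℝ} (hp : Continuous p) (hq : Continuous q) (h : ∀ x, 0 ≤ p x * q x)
    {s t : ℝ} (hs : p s < 0) (ht : 0 < p t) : ∃ x, p x = 0 ∧ q x = 0 := by
  have := isPreconnected_closed_iff.1 (isPreconnected_univ (α := ℝ))
    {x | p x ≤ 0 ∧ q x ≤ 0} {x | 0 ≤ p x ∧ 0 ≤ q x}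
    ((isClosed_le hp continuous_const).inter (isClosed_le hq continuous_const))
    ((isClosed_le continuous_const hp).inter (isClosed_le continuous_const hq))
    (fun x _ => (mul_nonneg_iff.1 (h x)).symm)
    ⟨s, trivial, hs.le, by have := h s; nlinarith⟩
    ⟨t, trivial, ht.le, by have := h t; nlinarith⟩
  obtain ⟨x, _, h1, h2⟩ := this
  exact ⟨x, le_antisymm h1.1 h2.1, le_antisymm h1.2 h2.2⟩

lemma eq_zero_of_ball {n} {p : MvPolynomial (Fin n) ℝ} {x₀ : Fin n → ℝ}
    (h : ∀ᶠ x in nhds x₀, eval x p = 0) : p = 0 := by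
  obtain ⟨ε, hε, h⟩ := Metric.eventually_nhds_iff.1 h
  refine funext_set (fun i => Metric.ball (x₀ i) ε) (fun i => ?_) fun x hx => ?_
  · rw [Real.ball_eq_Ioo]; exact Set.Ioo_infinite (by linarith)
  · rw [h, map_zero]
    rw [dist_pi_lt_iff hε]
    exact fun i => hx i trivial

lemma psd_cofactor {f k : MvPolynomial (Fin 3) ℝ} (h0 : f ≠ 0) (hf : Psd f) (h : Psd (f * k)) :
    Psd k := by
  intro u
  by_contra hu
  push Not at hu
  apply h0
  refine eq_zero_of_ball (x₀ := u) ?_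
  filter_upwards [(continuous_eval_poly k).continuousAt.eventually_lt_const hu] with x hx
  have h1 := hf x
  have h2 := h x
  rw [map_mul] at h2
  nlinarith

/-- Line-aligned form of the sign change situation -/
lemma sign_aligned {f : MvPolynomial (Fin 3) ℝ} {P Q : Fin 3 → ℝ} (hP : 0 < eval P f)
    (hQ : eval Q f < 0) : ∃ T : (Fin 3 → ℝ) ≃ₗ[ℝ] (Fin 3 → ℝ), ∃ s t : ℝ, ∃ x₀ : Fin 2 → ℝ,
    ∀ᶠ x in nhds x₀, eval (Fin.cons s x : Fin 3 → ℝ) (linEquiv T f) < 0 ∧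
      0 < eval (Fin.cons t x : Fin 3 → ℝ) (linEquiv T f) := by
  have hne : P - Q ≠ 0 := by
    intro h; rw [sub_eq_zero.1 h] at hP; linarith
  obtain ⟨v, hv⟩ := exists_indep2 hne
  obtain ⟨T, hT, -⟩ := exists_T hv
  have e : T.symm P = T.symm Q + E0 := by
    rw [← sub_eq_iff_eq_add', ← map_sub, ← hT]; simp
  have e1 : (Fin.cons (T.symm P 0) (Fin.tail (T.symm Q)) : Fin 3 → ℝ) = T.symm P := by
    rw [e]; ext i; fin_cases i
    · simp
    · change T.symm Q 1 = T.symm Q 1 + 0; simp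
    · change T.symm Q 2 = T.symm Q 2 + 0; simp
  have cont : ∀ s, Continuous fun x : Fin 2 → ℝ => eval (Fin.cons s x : Fin 3 → ℝ) (linEquiv T f) :=
    fun s => (continuous_eval_poly _).comp (by fun_prop)
  refine ⟨T, T.symm Q 0, T.symm P 0, Fin.tail (T.symm Q), ?_⟩
  refine ((cont _).continuousAt.eventually_lt_const ?_).and
    ((cont _).continuousAt.eventually_const_lt ?_)
  · beta_reduce; rw [Fin.cons_self_tail, eval_linEquiv]; simpa
  · beta_reduce; rw [e1, eval_linEquiv]; simpa

lemma cont_line (f : MvPolynomial (Fin 3) ℝ) (x : Fin 2 → ℝ) :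
    Continuous fun s : ℝ => eval (Fin.cons s x : Fin 3 → ℝ) f :=
  (continuous_eval_poly _).comp (by fun_prop)

lemma dvd_of_sign {f h : MvPolynomial (Fin 3) ℝ} (hf : Irreducible f) (hfh : Psd (f * h))
    {P Q : Fin 3 → ℝ} (hP : 0 < eval P f) (hQ : eval Q f < 0) : f ∣ h := by
  obtain ⟨T, s, t, x₀, hx⟩ := sign_aligned hP hQ
  have hfh' : ∀ v, 0 ≤ eval v (linEquiv T f) * eval v (linEquiv T h) := fun v => by
    have := hfh (T v); rw [map_mul] at this; rwa [eval_linEquiv, eval_linEquiv]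
  suffices linEquiv T f ∣ linEquiv T h from (map_dvd_iff (linEquiv T)).1 this
  have hi : Irreducible (linEquiv T f) := (MulEquiv.irreducible_iff (linEquiv T)).2 hf
  generalize linEquiv T f = f' at *
  generalize linEquiv T h = h' at *
  by_contra hnd
  have hi' : Irreducible (finSuccEquiv ℝ 2 f') := (MulEquiv.irreducible_iff (finSuccEquiv ℝ 2)).2 hi
  have hnd' : ¬ finSuccEquiv ℝ 2 f' ∣ finSuccEquiv ℝ 2 h' := fun h =>
    hnd ((map_dvd_iff (finSuccEquiv ℝ 2)).1 h)
  have hdeg : (finSuccEquiv ℝ 2 f').natDegree ≠ 0 := by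
    intro h0
    rw [Polynomial.natDegree_eq_zero] at h0
    obtain ⟨r, hr⟩ := h0
    have := hx.self_of_nhds
    rw [eval_eq_eval_mv_eval', eval_eq_eval_mv_eval', ← hr] at this
    simp at this
    linarith
  obtain ⟨a, b, r, hr, hab⟩ := bezout hi' hdeg hnd'
  apply hr
  refine eq_zero_of_ball (x₀ := x₀) ?_
  filter_upwards [hx] with x hx
  obtain ⟨y, h1, h2⟩ := common_zero (cont_line f' x) (cont_line h' x) (fun y => hfh' _) hx.1 hx.2
  rw [eval_eq_eval_mv_eval'] at h1 h2
  have := congrArg (fun p => Polynomial.eval y (Polynomial.map (eval x) p)) hab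
  simpa [h1, h2] using this.symm

lemma vanishAt_mk {f : MvPolynomial (Fin 3) ℝ} {d} (hf : f.IsHomogeneous d) {v : Fin 3 → ℝ}
    (hv : v ≠ 0) : VanishAt f (Projectivization.mk ℝ v hv) ↔ eval v f = 0 := by
  obtain ⟨a, ha⟩ := Projectivization.exists_smul_eq_mk_rep ℝ v hv
  rw [VanishAt, ← ha, Units.smul_def, eval_smul_form hf]
  simp

lemma mk_mem_VR {f : MvPolynomial (Fin 3) ℝ} {d} (hf : f.IsHomogeneous d) {v : Fin 3 → ℝ}
    (hv : v ≠ 0) : Projectivization.mk ℝ v hv ∈ VR f ↔ eval v f = 0 := vanishAt_mk hf hv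

/-- A parametrised family of zeros. -/
lemma infinite_of_family {f : MvPolynomial (Fin 3) ℝ} {d} (hf : f.IsHomogeneous d) {S : Set ℝ}
    (hS : S.Infinite) (γ : ℝ → Fin 3 → ℝ) (h0 : ∀ t ∈ S, γ t ≠ 0) (hz : ∀ t ∈ S, eval (γ t) f = 0)
    (hinj : ∀ s ∈ S, ∀ t ∈ S, ∀ a : ℝ, a • γ t = γ s → s = t) : (VR f).Infinite := by
  have : Infinite S := hS.to_subtype
  refine Set.infinite_of_injective_forall_mem
    (f := fun t : S => Projectivization.mk ℝ (γ t) (h0 t t.2)) ?_ ?_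
  · intro s t hst
    obtain ⟨a, ha⟩ := (Projectivization.mk_eq_mk_iff' _ _ _ _ _).1 hst
    exact Subtype.ext (hinj s s.2 t t.2 a ha)
  · intro t
    exact (mk_mem_VR hf _).2 (hz t t.2)

lemma infinite_of_sign {f : MvPolynomial (Fin 3) ℝ} {d} (hf : f.IsHomogeneous d)
    {P Q : Fin 3 → ℝ} (hP : 0 < eval P f) (hQ : eval Q f < 0) : (VR f).Infinite := by
  obtain ⟨T, s, t, x₀, hx⟩ := sign_aligned hP hQ
  obtain ⟨ε, hε, hx⟩ := Metric.eventually_nhds_iff.1 hx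
  obtain ⟨b, hb, hb0⟩ : ∃ b, dist b (x₀ 1) < ε ∧ b ≠ 0 := by
    by_cases h : x₀ 1 = 0
    · exact ⟨ε / 2, by rw [h, Real.dist_eq, sub_zero, abs_of_pos (by positivity)]; linarith,
        by positivity⟩
    · exact ⟨x₀ 1, by simpa, h⟩
  have key : ∀ a, ∃ y, a ∈ Metric.ball (x₀ 0) ε → eval (![y, a, b]) (linEquiv T f) = 0 := by
    intro a
    by_cases ha : a ∈ Metric.ball (x₀ 0) ε
    · have := @hx ![a, b] (by
        rw [dist_pi_lt_iff hε]; intro i; fin_cases i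
        · exact ha
        · exact hb)
      obtain ⟨y, hy⟩ := mem_range_of_exists_le_of_exists_ge (cont_line (linEquiv T f) ![a, b])
        ⟨s, this.1.le⟩ ⟨t, this.2.le⟩
      exact ⟨y, fun _ => hy⟩
    · exact ⟨0, fun h => absurd h ha⟩
  choose y hy using key
  refine infinite_of_family hf (S := Metric.ball (x₀ 0) ε) ?_ (fun a => T ![y a, a, b]) ?_ ?_ ?_
  · rw [Real.ball_eq_Ioo]; exact Set.Ioo_infinite (by linarith)
  · intro a _ h
    rw [map_eq_zero_iff T T.injective] at h
    exact hb0 (congrFun h 2)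
  · intro a ha
    rw [← eval_linEquiv]; exact hy a ha
  · intro a _ a' _ c h
    rw [← map_smul] at h
    have h := T.injective h
    have h2 := congrFun h 2
    have h1 := congrFun h 1
    simp at h1 h2
    have : c = 1 := mul_right_cancel₀ hb0 (by rw [h2, one_mul])
    rw [← h1, this, one_mul]

lemma quartic_sos {k : MvPolynomial (Fin 3) ℝ} (hk : k.IsHomogeneous 4) (hp : Psd k) :
    ∃ c : Fin 6 → Fin 6 → ℝ, k = ∑ i, qp (c i) ^ 2 := by
  obtain ⟨c, hc⟩ := hilbert (F := fun v => eval v k) ⟨k, hk, fun v => rfl⟩ hp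
  refine ⟨c, MvPolynomial.funext fun v => ?_⟩
  rw [hc]
  simp [eval_qp]

lemma quadratic_sos {h : MvPolynomial (Fin 3) ℝ} (hh : h.IsHomogeneous 2) (hp : Psd h) :
    ∃ c : Fin 6 → Fin 3 → ℝ,
      h = ∑ i, (C (c i 0) * X 0 + C (c i 1) * X 1 + C (c i 2) * X 2) ^ 2 := by
  obtain ⟨c, hc⟩ := quartic_sos (k := X 0 ^ 2 * h) (((isHomogeneous_X ℝ 0).pow 2).mul hh)
    (fun v => by rw [map_mul, map_pow]; exact mul_nonneg (sq_nonneg _) (hp v))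
  have h0 : ∀ i y z, qf (c i) ![0, y, z] = 0 := by
    intro i y z
    have := congrArg (eval ![0, y, z]) hc
    simp only [map_mul, map_pow, map_sum, eval_qp, eval_X, Matrix.cons_val_zero] at this
    have h2 : ∑ i, qf (c i) ![0, y, z] ^ 2 = 0 := by rw [← this]; ring
    rw [Finset.sum_eq_zero_iff_of_nonneg (fun k _ => sq_nonneg _)] at h2
    exact pow_eq_zero_iff (two_ne_zero) |>.1 (h2 i (Finset.mem_univ i))
  have h1 : ∀ i, c i 1 = 0 := fun i => by simpa [qf] using h0 i 1 0
  have h2 : ∀ i, c i 2 = 0 := fun i => by simpa [qf] using h0 i 0 1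
  have h3 : ∀ i, c i 3 = 0 := fun i => by simpa [qf, h1, h2] using h0 i 1 1
  refine ⟨fun i => ![c i 0, c i 5, c i 4], ?_⟩
  have hX : (X 0 ^ 2 : MvPolynomial (Fin 3) ℝ) ≠ 0 := pow_ne_zero _ (X_ne_zero 0)
  apply mul_left_cancel₀ hX
  rw [hc, Finset.mul_sum]
  refine Finset.sum_congr rfl fun i _ => ?_
  simp only [qp, h1, h2, h3, Matrix.cons_val_zero, Matrix.cons_val_one, Matrix.cons_val, map_zero]
  ring

lemma Sos.mul {f k : MvPolynomial (Fin 3) ℝ} (hf : Sos f) (hk : Sos k) : Sos (f * k) := by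
  obtain ⟨n, a, rfl⟩ := hf
  obtain ⟨m, b, rfl⟩ := hk
  refine ⟨n * m, fun i => a (finProdFinEquiv.symm i).1 * b (finProdFinEquiv.symm i).2, ?_⟩
  rw [Finset.sum_mul_sum, ← Fintype.sum_prod_type', ← finProdFinEquiv.symm.sum_comp]
  exact Finset.sum_congr rfl fun i _ => by ring

lemma Sos.sq (f : MvPolynomial (Fin 3) ℝ) : Sos (f ^ 2) := ⟨1, fun _ => f, by simp⟩

lemma line_inf {f : MvPolynomial (Fin 3) ℝ} {d} (hf : f.IsHomogeneous d) {u v : Fin 3 → ℝ}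
    (h : LinearIndependent ℝ ![u, v]) (hz : ∀ t : ℝ, eval (u + t • v) f = 0) :
    (VR f).Infinite := by
  rw [LinearIndependent.pair_iff] at h
  refine infinite_of_family hf Set.infinite_univ (fun t => u + t • v) ?_ (fun t _ => hz t) ?_
  · intro t _ h0
    exact one_ne_zero (h 1 t (by simpa using h0)).1
  · intro s _ t _ a ha
    have := h (a - 1) (a * t - s) (by
      have : a • (u + t • v) - (u + s • v) = 0 := sub_eq_zero.2 ha
      rw [← this]; module)
    have h1 : a = 1 := by linarith [this.1]
    rw [h1] at this
    linarith [this.2]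

lemma quadratic_zeros {h : MvPolynomial (Fin 3) ℝ} (hh : h.IsHomogeneous 2) (hp : Psd h) :
    (VR h).encard ≤ 1 ∨ (VR h).Infinite := by
  obtain ⟨c, hc⟩ := quadratic_sos hh hp
  rw [Set.encard_le_one_iff]
  by_contra hcon
  push Not at hcon
  obtain ⟨⟨P, Q, hP, hQ, hPQ⟩, hfin⟩ := hcon
  have key : ∀ v, eval v h = 0 ↔ ∀ i, c i 0 * v 0 + c i 1 * v 1 + c i 2 * v 2 = 0 := by
    intro v
    rw [hc]
    simp only [map_sum, map_pow, map_add, map_mul, eval_C, eval_X]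
    rw [Finset.sum_eq_zero_iff_of_nonneg (fun k _ => sq_nonneg _)]
    simp
  have hP := (key _).1 hP
  have hQ := (key _).1 hQ
  refine absurd (line_inf hh (Projectivization.linearIndependent_pair_iff_ne.2 hPQ) fun t => ?_)
    (Set.not_infinite.2 hfin)
  rw [key]
  intro i
  simp only [Pi.add_apply, Pi.smul_apply, smul_eq_mul]
  linear_combination hP i + t * hQ i

lemma qf_polar (c : Fin 6 → ℝ) (u v : Fin 3 → ℝ) (a b : ℝ) : qf c (a • u + b • v) =
    a ^ 2 * qf c u + b ^ 2 * qf c v + a * b * (qf c (u + v) - qf c u - qf c v) := by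
  simp only [qf, Pi.add_apply, Pi.smul_apply, smul_eq_mul]
  ring

lemma collinear_inf {n} {k : MvPolynomial (Fin 3) ℝ} {d} (hk : k.IsHomogeneous d)
    {c : Fin n → Fin 6 → ℝ}
    (key : ∀ v, eval v k = 0 ↔ ∀ i, qf (c i) v = 0) {u v w : Fin 3 → ℝ}
    (huv : LinearIndependent ℝ ![u, v]) (huw : LinearIndependent ℝ ![u, w])
    (hvw : LinearIndependent ℝ ![v, w]) (hu : eval u k = 0) (hv : eval v k = 0)
    (hw : eval w k = 0) {a b : ℝ} (hab : a • u + b • v = w) : (VR k).Infinite := by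
  have ha : a ≠ 0 := by
    rintro rfl
    have := LinearIndependent.pair_iff.1 hvw b (-1) (by rw [← hab]; module)
    linarith [this.2]
  have hb : b ≠ 0 := by
    rintro rfl
    have := LinearIndependent.pair_iff.1 huw a (-1) (by rw [← hab]; module)
    linarith [this.2]
  rw [key] at hu hv hw
  refine line_inf hk huv fun t => ?_
  rw [key]
  intro i
  have h1 := hw i
  rw [← hab, qf_polar, hu i, hv i] at h1
  have h2 : qf (c i) (u + v) = 0 := by
    have h3 : a * b * qf (c i) (u + v) = 0 := by linear_combination h1
    exact (mul_eq_zero.1 h3).resolve_left (mul_ne_zero ha hb)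
  have := qf_polar (c i) u v 1 t
  rw [one_smul] at this
  rw [this, hu i, hv i, h2]; ring

lemma conic_inf {n} {k : MvPolynomial (Fin 3) ℝ} {d} (hk : k.IsHomogeneous d)
    {c : Fin n → Fin 6 → ℝ}
    (key : ∀ v, eval v k = 0 ↔ ∀ i, qf (c i) v = 0) {v : Fin 5 → Fin 3 → ℝ}
    (hv : ∀ i, eval (v i) k = 0) (hpair : ∀ i j, i ≠ j → LinearIndependent ℝ ![v i, v j])
    (hcol : ∀ i j l, i ≠ j → i ≠ l → j ≠ l → ∀ a b : ℝ, a • v i + b • v j ≠ v l) :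
    (VR k).Infinite := by
  have h3 : LinearIndependent ℝ ![v 0, v 1, v 2] := by
    refine LinearIndependent.finCons (hpair 1 2 (by decide)) ?_
    rw [Matrix.range_cons, Matrix.range_cons, Matrix.range_empty, Set.union_empty,
      Set.singleton_union, Submodule.mem_span_pair]
    rintro ⟨a, b, h⟩
    exact hcol 1 2 0 (by decide) (by decide) (by decide) a b h
  obtain ⟨T, hT⟩ := exists_equiv3 h3
  have hco : ∀ i, ∃ c', ∀ x, qf (c i) (T x) = qf c' x := fun i =>
    ((qf_isForm (c i)).comp T.toLinearMap).two
  choose c' hc' using hco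
  have key' : ∀ x, eval (T x) k = 0 ↔ ∀ i, qf (c' i) x = 0 := fun x => by
    rw [key]; simp only [hc']
  have z0 : ∀ i, c' i 0 = 0 := fun i => by
    have := (key' ![1, 0, 0]).1 (by rw [hT]; simpa using hv 0) i
    simpa [qf] using this
  have z1 : ∀ i, c' i 1 = 0 := fun i => by
    have := (key' ![0, 1, 0]).1 (by rw [hT]; simpa using hv 1) i
    simpa [qf] using this
  have z2 : ∀ i, c' i 2 = 0 := fun i => by
    have := (key' ![0, 0, 1]).1 (by rw [hT]; simpa using hv 2) i
    simpa [qf] using this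
  have key'' : ∀ x, eval (T x) k = 0 ↔
      ∀ i, c' i 3 * (x 1 * x 2) + c' i 4 * (x 0 * x 2) + c' i 5 * (x 0 * x 1) = 0 := fun x => by
    rw [key']
    refine forall_congr' fun i => ?_
    simp only [qf, z0, z1, z2]
    constructor <;> intro h <;> linear_combination h
  have nz : ∀ j, j ≠ 0 → j ≠ 1 → j ≠ 2 → ∀ l, T.symm (v j) l ≠ 0 := by
    intro j j0 j1 j2 l hl
    have e : v j = T (T.symm (v j)) := by simp
    rw [hT] at e
    fin_cases l
    · exact hcol 1 2 j (by decide) j1.symm j2.symm _ _ (by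
        rw [e, show T.symm (v j) 0 = 0 from hl]; module)
    · exact hcol 0 2 j (by decide) j0.symm j2.symm _ _ (by
        rw [e, show T.symm (v j) 1 = 0 from hl]; module)
    · exact hcol 0 1 j (by decide) j0.symm j1.symm _ _ (by
        rw [e, show T.symm (v j) 2 = 0 from hl]; module)
  have p3 := nz 3 (by decide) (by decide) (by decide)
  have p4 := nz 4 (by decide) (by decide) (by decide)
  have q3 := (key'' (T.symm (v 3))).1 (by simpa using hv 3)
  have q4 := (key'' (T.symm (v 4))).1 (by simpa using hv 4)
  have hpr : ∀ s t : ℝ, s • T.symm (v 3) + t • T.symm (v 4) = 0 → s = 0 ∧ t = 0 := by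
    intro s t h
    refine LinearIndependent.pair_iff.1 (hpair 3 4 (by decide)) s t ?_
    rw [← map_smul, ← map_smul, ← map_add] at h
    exact (map_eq_zero_iff _ T.symm.injective).1 h
  generalize T.symm (v 3) = p at *
  generalize T.symm (v 4) = q at *
  obtain ⟨n0, hn0⟩ : ∃ n0, n0 = p 0 * q 0 * (p 2 * q 1 - p 1 * q 2) := ⟨_, rfl⟩
  obtain ⟨n1, hn1⟩ : ∃ n1, n1 = p 1 * q 1 * (p 0 * q 2 - p 2 * q 0) := ⟨_, rfl⟩
  obtain ⟨n2, hn2⟩ : ∃ n2, n2 = p 2 * q 2 * (p 1 * q 0 - p 0 * q 1) := ⟨_, rfl⟩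
  have r1 : ∀ i, c' i 3 * n1 = c' i 4 * n0 := fun i => by
    rw [hn1, hn0]
    linear_combination (p 0 * p 1) * q4 i - (q 0 * q 1) * q3 i
  have r2 : ∀ i, c' i 3 * n2 = c' i 5 * n0 := fun i => by
    rw [hn2, hn0]
    linear_combination - (p 0 * p 2) * q4 i + (q 0 * q 2) * q3 i
  by_cases hn : n1 = 0 ∧ n2 = 0
  · have hn00 : n0 ≠ 0 := by
      intro h00
      have a0 : p 2 * q 1 - p 1 * q 2 = 0 :=
        (mul_eq_zero.1 (hn0.symm.trans h00)).resolve_left (mul_ne_zero (p3 0) (p4 0))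
      have a1 : p 0 * q 2 - p 2 * q 0 = 0 :=
        (mul_eq_zero.1 (hn1.symm.trans hn.1)).resolve_left (mul_ne_zero (p3 1) (p4 1))
      have a2 : p 1 * q 0 - p 0 * q 1 = 0 :=
        (mul_eq_zero.1 (hn2.symm.trans hn.2)).resolve_left (mul_ne_zero (p3 2) (p4 2))
      refine p4 0 (hpr (q 0) (- p 0) ?_).1
      ext j
      fin_cases j
      · simp; ring
      · simp; linear_combination a2
      · simp; linear_combination -a1
    have b0 : ∀ i, c' i 4 = 0 := fun i => by
      have := r1 i; rw [hn.1, mul_zero] at this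
      exact (mul_eq_zero.1 this.symm).resolve_right hn00
    have b1 : ∀ i, c' i 5 = 0 := fun i => by
      have := r2 i; rw [hn.2, mul_zero] at this
      exact (mul_eq_zero.1 this.symm).resolve_right hn00
    refine infinite_of_family hk Set.infinite_univ (fun t => T ![1, 0, t]) ?_ ?_ ?_
    · intro t _ h
      rw [map_eq_zero_iff T T.injective] at h
      exact one_ne_zero (congrFun h 0)
    · intro t _
      rw [key'']; intro i; simp [b0, b1]
    · intro s _ t _ a h
      rw [← map_smul] at h
      have h := T.injective h
      have h2 := congrFun h 2
      have h1 := congrFun h 0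
      simp at h1 h2
      rw [← h2, h1, one_mul]
  · have hS : {t : ℝ | n1 * t + n2 ≠ 0}.Infinite := by
      have : {t : ℝ | n1 * t + n2 = 0}.Finite := by
        refine Set.Subsingleton.finite ?_
        intro s hs t ht
        simp only [Set.mem_setOf_eq] at hs ht
        have h1 : n1 ≠ 0 := by
          rintro h1
          exact hn ⟨h1, by rw [h1] at hs; linarith⟩
        exact mul_left_cancel₀ h1 (by linarith)
      exact this.infinite_compl
    refine infinite_of_family hk hS
      (fun t => T ![-n0 * t, n1 * t + n2, t * (n1 * t + n2)]) ?_ ?_ ?_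
    · intro t ht h
      rw [map_eq_zero_iff T T.injective] at h
      exact ht (congrFun h 1)
    · intro t _
      rw [key'']; intro i; simp
      linear_combination (t * (n1 * t + n2)) * (t * r1 i + r2 i)
    · intro s hs t ht a h
      rw [← map_smul] at h
      have h := T.injective h
      have h2 := congrFun h 2
      have h1 := congrFun h 1
      simp at h1 h2
      simp only [Set.mem_setOf_eq] at hs ht
      have : (s - t) * (n1 * s + n2) = 0 := by linear_combination t * h1 - h2
      exact sub_eq_zero.1 ((mul_eq_zero.1 this).resolve_right hs)

lemma quartic_zeros {k : MvPolynomial (Fin 3) ℝ} (hk : k.IsHomogeneous 4) (hp : Psd k) :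
    (VR k).encard ≤ 4 ∨ (VR k).Infinite := by
  obtain ⟨c, hc⟩ := quartic_sos hk hp
  have key : ∀ v, eval v k = 0 ↔ ∀ i, qf (c i) v = 0 := by
    intro v
    rw [hc]
    simp only [map_sum, map_pow, eval_qp]
    rw [Finset.sum_eq_zero_iff_of_nonneg (fun k _ => sq_nonneg _)]
    simp
  by_cases h4 : (VR k).encard ≤ 4
  · exact Or.inl h4
  right
  have h5 : (5 : ℕ∞) ≤ (VR k).encard := by
    have := Order.add_one_le_of_lt (not_le.1 h4)
    exact this
  obtain ⟨t, hts, ht⟩ := Set.exists_subset_encard_eq h5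
  have htf : t.Finite := Set.finite_of_encard_eq_coe (k := 5) ht
  have : Finite t := htf
  have hcard : Nat.card t = 5 := by
    change (Set.encard t).toNat = 5
    rw [ht]; rfl
  let e := (Finite.equivFinOfCardEq hcard).symm
  have hv : ∀ i, eval (e i).1.rep k = 0 := fun i => hts (e i).2
  have hpair : ∀ i j, i ≠ j → LinearIndependent ℝ ![(e i).1.rep, (e j).1.rep] := fun i j hij => by
    rw [Projectivization.linearIndependent_pair_iff_ne]
    intro h
    exact hij (e.injective (Subtype.ext h))
  by_cases hcol : ∀ i j l, i ≠ j → i ≠ l → j ≠ l → ∀ a b : ℝ,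
      a • (e i).1.rep + b • (e j).1.rep ≠ (e l).1.rep
  · exact conic_inf hk key (v := fun i => (e i).1.rep) hv hpair hcol
  · push Not at hcol
    obtain ⟨i, j, l, hij, hil, hjl, a, b, hab⟩ := hcol
    exact collinear_inf hk key (hpair i j hij) (hpair i l hil) (hpair j l hjl) (hv i) (hv j) (hv l)
      hab

lemma VR_mul (f k : MvPolynomial (Fin 3) ℝ) : VR (f * k) = VR f ∪ VR k := by
  ext P
  change eval P.rep (f * k) = 0 ↔ eval P.rep f = 0 ∨ eval P.rep k = 0
  rw [map_mul, mul_eq_zero]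

lemma psd_sos {h : MvPolynomial (Fin 3) ℝ} {m} (hm : m = 0 ∨ m = 2 ∨ m = 4)
    (hh : h.IsHomogeneous m) (hp : Psd h) : Sos h := by
  rcases hm with rfl | rfl | rfl
  · rw [totalDegree_eq_zero_iff_eq_C.1 (Nat.le_zero.1 hh.totalDegree_le)]
    have h0 : 0 ≤ coeff 0 h := by
      have := hp 0
      rwa [eval_zero] at this
    refine ⟨1, fun _ => C (Real.sqrt (coeff 0 h)), ?_⟩
    rw [Fin.sum_univ_one, ← map_pow, Real.sq_sqrt h0]
  · obtain ⟨c, hc⟩ := quadratic_sos hh hp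
    exact ⟨6, _, hc⟩
  · obtain ⟨c, hc⟩ := quartic_sos hh hp
    exact ⟨6, _, hc⟩

lemma case_psd {f k : MvPolynomial (Fin 3) ℝ} (hf0 : f ≠ 0) (hf : f.IsHomogeneous 2)
    (hk : k.IsHomogeneous 4) (hpf : Psd f) (hp : Psd (f * k)) :
    Sos (f * k) ∧ ((VR (f * k)).encard ≤ 5 ∨ (VR (f * k)).Infinite) := by
  have hpk := psd_cofactor hf0 hpf hp
  refine ⟨(psd_sos (by simp) hf hpf).mul (psd_sos (by simp) hk hpk), ?_⟩
  rw [VR_mul]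
  rcases quadratic_zeros hf hpf with h1 | h1
  · rcases quartic_zeros hk hpk with h2 | h2
    · left
      calc (VR f ∪ VR k).encard ≤ (VR f).encard + (VR k).encard := Set.encard_union_le _ _
        _ ≤ 1 + 4 := add_le_add h1 h2
        _ = 5 := by norm_num
    · exact Or.inr (h2.mono Set.subset_union_right)
  · exact Or.inr (h1.mono Set.subset_union_left)

lemma case_irred {f k : MvPolynomial (Fin 3) ℝ} {n m : ℕ} (hfi : Irreducible f)
    (hk0 : k ≠ 0)
    (hf : f.IsHomogeneous n) (hk : k.IsHomogeneous m) (hnm : n + m = 6) (hn : 1 ≤ n) (hn3 : n ≤ 3)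
    (hp : Psd (f * k)) :
    Sos (f * k) ∧ ((VR (f * k)).encard ≤ 5 ∨ (VR (f * k)).Infinite) := by
  have hf0 := hfi.ne_zero
  by_cases hs : (∃ P, 0 < eval P f) ∧ (∃ Q, eval Q f < 0)
  · obtain ⟨⟨P, hP⟩, Q, hQ⟩ := hs
    refine ⟨?_, Or.inr ?_⟩
    · obtain ⟨h, rfl⟩ := dvd_of_sign hfi hp hP hQ
      have hh0 : h ≠ 0 := right_ne_zero_of_mul hk0
      obtain ⟨l, hl⟩ := factor_homog (p := h) (q := f) (by rw [mul_comm]; exact hk)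
        (by rw [mul_comm]; exact hk0)
      have hm : n + l = m := IsHomogeneous.inj_right (hf.mul hl) hk hk0
      have e : f * (f * h) = f ^ 2 * h := by ring
      rw [e] at hp ⊢
      have hph : Psd h := psd_cofactor (pow_ne_zero 2 hf0)
        (fun v => by rw [map_pow]; exact sq_nonneg _) hp
      exact (Sos.sq f).mul (psd_sos (by omega) hl hph)
    · rw [VR_mul]
      exact (infinite_of_sign hf hP hQ).mono Set.subset_union_left
  · have hn2 : n = 2 := by
      by_contra hne
      have hodd : Odd n := by
        have : n = 1 ∨ n = 3 := by omega
        rcases this with rfl | rfl <;> decide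
      obtain ⟨v, hv⟩ : ∃ v, eval v f ≠ 0 := by
        by_contra hcon
        push Not at hcon
        exact hf0 (MvPolynomial.funext fun v => by rw [hcon, map_zero])
      have h1 := eval_smul_form hf (-1) v
      rw [hodd.neg_one_pow] at h1
      apply hs
      rcases lt_or_gt_of_ne hv with h | h
      · exact ⟨⟨_, by rw [h1]; linarith⟩, v, h⟩
      · exact ⟨⟨v, h⟩, _, by rw [h1]; linarith⟩
    subst hn2
    obtain rfl : m = 4 := by omega
    by_cases hpos : ∃ P, 0 < eval P f
    · have hpf : Psd f := fun v => by
        by_contra hv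
        exact hs ⟨hpos, v, not_le.1 hv⟩
      exact case_psd hf0 hf hk hpf hp
    · push Not at hpos
      have := case_psd (f := -f) (k := -k) (neg_ne_zero.2 hf0) hf.neg hk.neg
        (fun v => by rw [map_neg]; linarith [hpos v]) (by rwa [neg_mul_neg])
      rwa [neg_mul_neg] at this

lemma main_aux {g₁ g₂ : MvPolynomial (Fin 3) ℝ} {d₁ d₂ : ℕ} (h0 : g₁ * g₂ ≠ 0)
    (hpsd : Psd (g₁ * g₂))
    (h1 : g₁.IsHomogeneous d₁) (h2 : g₂.IsHomogeneous d₂)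
    (hd1 : 0 < d₁) (hd : d₁ + d₂ = 6) (h3 : d₁ ≤ 3) :
    Sos (g₁ * g₂) ∧ ((VR (g₁ * g₂)).encard ≤ 5 ∨ (VR (g₁ * g₂)).Infinite) := by
  have hg1 : g₁ ≠ 0 := left_ne_zero_of_mul h0
  have hg2 : g₂ ≠ 0 := right_ne_zero_of_mul h0
  have hu : ¬ IsUnit g₁ := by
    intro hu
    have h5 := (hu.map (eval (0 : Fin 3 → ℝ))).ne_zero
    have h4 := eval_smul_form h1 0 0
    rw [zero_smul, zero_pow hd1.ne', zero_mul] at h4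
    exact h5 h4
  obtain ⟨f, hfi, r, rfl⟩ := WfDvdMonoid.exists_irreducible_factor hu hg1
  obtain ⟨n, hn⟩ := factor_homog h1 hg1
  obtain ⟨l, hl⟩ := factor_homog (p := r) (q := f) (by rw [mul_comm]; exact h1)
    (by rw [mul_comm]; exact hg1)
  have hnl : n + l = d₁ := IsHomogeneous.inj_right (hn.mul hl) h1 hg1
  have hn1 : 1 ≤ n := by
    by_contra hlt
    obtain rfl : n = 0 := by omega
    have e := totalDegree_eq_zero_iff_eq_C.1 (Nat.le_zero.1 hn.totalDegree_le)
    apply hfi.not_isUnit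
    rw [e]
    refine (IsUnit.mk0 _ ?_).map C
    intro h
    rw [h, map_zero] at e
    exact hfi.ne_zero e
  rw [mul_assoc] at hpsd ⊢
  exact case_irred hfi (mul_ne_zero (right_ne_zero_of_mul hg1) hg2) hn (hl.mul h2) (by omega) hn1
    (by omega) hpsd

theorem statement9 (g g₁ g₂ : MvPolynomial (Fin 3) ℝ) (d₁ d₂ : ℕ)
    (hg6 : g.IsHomogeneous 6) (hpsd : Psd g)
    (h1 : g₁.IsHomogeneous d₁) (h2 : g₂.IsHomogeneous d₂)
    (hd1 : 0 < d₁) (hd2 : 0 < d₂) (hmul : g = g₁ * g₂) :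
    Sos g ∧ ((VR g).encard ≤ 5 ∨ (VR g).Infinite) := by
  by_cases h0 : g = 0
  · subst h0
    refine ⟨⟨0, fun _ => 0, by simp⟩, Or.inr ?_⟩
    obtain ⟨v, hv⟩ := exists_indep2 (u := E0) (by intro h; simpa [E0] using congrFun h 0)
    exact line_inf hg6 hv fun t => map_zero _
  subst hmul
  have hd : d₁ + d₂ = 6 := IsHomogeneous.inj_right (h1.mul h2) hg6 h0
  by_cases h3 : d₁ ≤ 3
  · exact main_aux h0 hpsd h1 h2 hd1 hd h3
  · rw [mul_comm] at h0 hpsd ⊢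
    exact main_aux h0 hpsd h2 h1 hd2 (by omega) (by omega)

end
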